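/- Let S = R ∪ B be a bicolored point set in convex position with |R| = |B| = n ≥ 2, and let r ∈ R and b ∈ B be consecutive points in the circular order of S. Then every optimum Hamiltonian alternating path on S with endpoints r and b has exactly n − r(S) crossings, is 1-plane, and contains every bridge of S as an edge except for the edge rb. -/

import Mathlib

open scoped Classical

noncomputable section

/-- Points of the plane. -/
abbrev Pt := ℝ × ℝ

/-- Orientation determinant of the ordered triple `(a, b, c)`. -/
def det2 (a b c : Pt) : ℝ :=
  (b.1 - a.1) * (c.2 - a.2) - (b.2 - a.2) * (c.1 - a.1)

/-- Two closed segments cross: some point lies in the relative interior of both. -/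
def SegCross (e f : Pt × Pt) : Prop :=
  ∃ x : Pt, x ∈ openSegment ℝ e.1 e.2 ∧ x ∈ openSegment ℝ f.1 f.2

/-- Number of crossings (unordered pairs of crossing edges) among a list of edges. -/
def crossNum (es : List (Pt × Pt)) : ℕ :=
  ((Finset.range es.length ×ˢ Finset.range es.length).filter
    (fun ij => ij.1 < ij.2 ∧
      SegCross (es.getD ij.1 ((0, 0), (0, 0))) (es.getD ij.2 ((0, 0), (0, 0))))).card

/-- Number of other edges crossing the `i`-th edge of the list. -/
def edgeCrossCount (es : List (Pt × Pt)) (i : ℕ) : ℕ :=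
  ((Finset.range es.length).filter (fun j => j ≠ i ∧
      SegCross (es.getD i ((0, 0), (0, 0))) (es.getD j ((0, 0), (0, 0))))).card

/-- Every edge is crossed by at most one other edge. -/
def OnePlane (es : List (Pt × Pt)) : Prop :=
  ∀ i ∈ Finset.range es.length, edgeCrossCount es i ≤ 1

/-- The edges of a path given by its list of vertices. -/
def pathEdges (l : List Pt) : List (Pt × Pt) := l.zip l.tail

/-- The edges of a cycle given by its list of vertices (including the wrap-around edge). -/
def cycleEdges (l : List Pt) : List (Pt × Pt) := l.zip (l.rotate 1)

/-- An edge joining a point of `R` to a point of `B`. -/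
def Bichromatic (R B : Finset Pt) (e : Pt × Pt) : Prop :=
  (e.1 ∈ R ∧ e.2 ∈ B) ∨ (e.1 ∈ B ∧ e.2 ∈ R)

/-- A Hamiltonian alternating path on the bicolored point set `R ∪ B`
with endpoints `p` and `q`. -/
structure HamAltPath (R B : Finset Pt) (p q : Pt) where
  verts : List Pt
  nodup : verts.Nodup
  cover : verts.toFinset = R ∪ B
  head_eq : verts.head? = some p
  last_eq : verts.getLast? = some q
  alt : ∀ e ∈ pathEdges verts, Bichromatic R B e

/-- A Hamiltonian alternating cycle on the bicolored point set `R ∪ B`. -/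
structure HamAltCycle (R B : Finset Pt) where
  verts : List Pt
  nodup : verts.Nodup
  cover : verts.toFinset = R ∪ B
  alt : ∀ e ∈ cycleEdges verts, Bichromatic R B e

/-- A Hamiltonian alternating path with prescribed endpoints is optimum if it has the
minimum number of crossings among all such paths. -/
def OptimumPath (R B : Finset Pt) (p q : Pt) (P : HamAltPath R B p q) : Prop :=
  ∀ Q : HamAltPath R B p q, crossNum (pathEdges P.verts) ≤ crossNum (pathEdges Q.verts)

/-- No three points of `S` are collinear. -/
def GeneralPosition (S : Finset Pt) : Prop :=
  ∀ p ∈ S, ∀ q ∈ S, ∀ r ∈ S, p ≠ q → p ≠ r → q ≠ r → ¬ Collinear ℝ ({p, q, r} : Set Pt)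

/-- Every point of `S` is a vertex (extreme point) of its convex hull. -/
def ConvexPosition (S : Finset Pt) : Prop :=
  ∀ p ∈ S, p ∉ convexHull ℝ ((S.erase p : Finset Pt) : Set Pt)

/-- The points of `S` lying on the boundary of the convex hull of `S`
(i.e. the extreme points of `S`). -/
def hullPts (S : Finset Pt) : Finset Pt :=
  S.filter fun p => p ∉ convexHull ℝ ((S.erase p : Finset Pt) : Set Pt)

/-- Cyclic successor on `Fin m`. -/
def cycSucc {m : ℕ} (hm : 0 < m) (i : Fin m) : Fin m :=
  ⟨(i.val + 1) % m, Nat.mod_lt _ hm⟩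

/-- Cyclic predecessor on `Fin m`. -/
def cycPred {m : ℕ} (hm : 0 < m) (i : Fin m) : Fin m :=
  ⟨(i.val + (m - 1)) % m, Nat.mod_lt _ hm⟩

/-- `pt` lists points in convex position, in clockwise circular order:
every index-increasing triple is clockwise oriented. -/
def CWList {m : ℕ} (pt : Fin m → Pt) : Prop :=
  Function.Injective pt ∧
    ∀ i j k : Fin m, i < j → j < k → det2 (pt i) (pt j) (pt k) < 0

/-- `pt` is a clockwise listing of the points of `S` on the boundary of `CH(S)`. -/
def IsHullList (S : Finset Pt) {m : ℕ} (pt : Fin m → Pt) : Prop :=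
  CWList pt ∧ Finset.univ.image pt = hullPts S

/-- The number of runs of color `A` (with other color `C`) in the cyclic sequence `pt`:
a run starts at an `A`-point whose cyclic predecessor is a `C`-point; a completely
`A`-colored cycle forms a single run. -/
def runCount {m : ℕ} (hm : 0 < m) (A C : Finset Pt) (pt : Fin m → Pt) : ℕ :=
  if ∀ i : Fin m, pt i ∈ A then 1
  else (Finset.univ.filter fun i : Fin m => pt i ∈ A ∧ pt (cycPred hm i) ∈ C).card

/-- `q` is the counterclockwise radial order of the points of `T` around `r`. -/
def CCWOrder (r : Pt) {k : ℕ} (q : Fin k → Pt) (T : Finset Pt) : Prop :=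
  Function.Injective q ∧ Finset.univ.image q = T ∧
    ∀ i j : Fin k, i < j → 0 < det2 r (q i) (q j)

/-- `q` is the clockwise radial order of the points of `T` around `r`. -/
def CWOrder (r : Pt) {k : ℕ} (q : Fin k → Pt) (T : Finset Pt) : Prop :=
  Function.Injective q ∧ Finset.univ.image q = T ∧
    ∀ i j : Fin k, i < j → det2 r (q i) (q j) < 0

/-- Counting one extra point of color `A` (the center), the initial segment
`q 0, …, q j` contains equally many points of color `A` and of color `C`. -/
def BalancedAt (A C : Finset Pt) {k : ℕ} (q : Fin k → Pt) (j : Fin k) : Prop :=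
  1 + (Finset.univ.filter fun i : Fin k => i ≤ j ∧ q i ∈ A).card
    = (Finset.univ.filter fun i : Fin k => i ≤ j ∧ q i ∈ C).card

/-- `j` is the first balanced index of the sequence `q`. -/
def FirstBalanced (A C : Finset Pt) {k : ℕ} (q : Fin k → Pt) (j : Fin k) : Prop :=
  BalancedAt A C q j ∧ ∀ j' : Fin k, j' < j → ¬ BalancedAt A C q j'

/-- The triple `(R ∪ B, r, b)` is a special configuration (Definition 2.2):
(i) both neighbors of `r` on the hull boundary are red and both neighbors of `b` are
blue; (ii) in the counterclockwise and clockwise radial orders around `r`, the first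
balanced point is `b`; (iii) symmetrically around `b`, the first balanced point is `r`. -/
def SpecialConfig (R B : Finset Pt) (r b : Pt) : Prop :=
  r ∈ hullPts (R ∪ B) ∧ b ∈ hullPts (R ∪ B) ∧
  (∀ (m : ℕ) (hm : 0 < m) (pt : Fin m → Pt), IsHullList (R ∪ B) pt →
    ∀ i : Fin m,
      (pt i = r → pt (cycPred hm i) ∈ R ∧ pt (cycSucc hm i) ∈ R) ∧
      (pt i = b → pt (cycPred hm i) ∈ B ∧ pt (cycSucc hm i) ∈ B)) ∧
  (∀ (k : ℕ) (q : Fin k → Pt),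
      (CCWOrder r q ((R ∪ B).erase r) ∨ CWOrder r q ((R ∪ B).erase r)) →
      ∀ j : Fin k, FirstBalanced R B q j → q j = b) ∧
  (∀ (k : ℕ) (q : Fin k → Pt),
      (CCWOrder b q ((R ∪ B).erase b) ∨ CWOrder b q ((R ∪ B).erase b)) →
      ∀ j : Fin k, FirstBalanced B R q j → q j = r)

/-- The unordered pair `{a, b}` occurs as an edge of the list `es`. -/
def IsEdgeOf (es : List (Pt × Pt)) (a b : Pt) : Prop := (a, b) ∈ es ∨ (b, a) ∈ es

/-- The clockwise cyclic interval of indices from `a` to `b`, inclusive. -/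
def cycIdx {m : ℕ} (hm : 0 < m) (a b : Fin m) : Finset (Fin m) :=
  (Finset.range ((b.val + m - a.val) % m + 1)).image
    fun t => (⟨(a.val + t) % m, Nat.mod_lt _ hm⟩ : Fin m)

/-- Two chords, given by unordered pairs of positions on a circle cut open to `ℕ`, cross:
one endpoint of the second lies strictly inside the first and the other strictly outside. -/
def ChordCross (e f : Sym2 ℕ) : Prop :=
  ∃ a b c d, e = s(a, b) ∧ f = s(c, d) ∧ a < c ∧ c < b ∧ (d < a ∨ b < d)

theorem chordCross_mk {a b c d : ℕ} : ChordCross s(a, b) s(c, d) ↔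
    (a < c ∧ c < b ∧ (d < a ∨ b < d)) ∨ (b < c ∧ c < a ∧ (d < b ∨ a < d)) ∨
    (a < d ∧ d < b ∧ (c < a ∨ b < c)) ∨ (b < d ∧ d < a ∧ (c < b ∨ a < c)) := by
  constructor
  · rintro ⟨x, y, z, t, h1, h2, h3⟩
    rw [Sym2.eq_iff] at h1 h2
    rcases h1 with ⟨rfl, rfl⟩ | ⟨rfl, rfl⟩ <;> rcases h2 with ⟨rfl, rfl⟩ | ⟨rfl, rfl⟩ <;> tauto
  · rintro (h | h | h | h)
    · exact ⟨a, b, c, d, rfl, rfl, h⟩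
    · exact ⟨b, a, c, d, Sym2.eq_swap, rfl, h⟩
    · exact ⟨a, b, d, c, rfl, Sym2.eq_swap, h⟩
    · exact ⟨b, a, d, c, Sym2.eq_swap, Sym2.eq_swap, h⟩

theorem ChordCross.symm {e f : Sym2 ℕ} (h : ChordCross e f) : ChordCross f e := by
  induction e with | _ a b
  induction f with | _ c d
  rw [chordCross_mk] at *
  omega

theorem chordCross_comm {e f : Sym2 ℕ} : ChordCross e f ↔ ChordCross f e :=
  ⟨ChordCross.symm, ChordCross.symm⟩

theorem not_chordCross_self (e : Sym2 ℕ) : ¬ ChordCross e e := by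
  induction e with | _ a b
  rw [chordCross_mk]
  omega

theorem ChordCross.ne {e f : Sym2 ℕ} (h : ChordCross e f) : e ≠ f := by
  rintro rfl
  exact not_chordCross_self e h

/-- The indicator of crossing. -/
def cr (e f : Sym2 ℕ) : ℕ := if ChordCross e f then 1 else 0

theorem cr_comm (e f : Sym2 ℕ) : cr e f = cr f e := by
  simp only [cr, chordCross_comm]

theorem cr_self (e : Sym2 ℕ) : cr e e = 0 := if_neg (not_chordCross_self e)

theorem cr_eq_zero {e f : Sym2 ℕ} : cr e f = 0 ↔ ¬ ChordCross e f := by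
  simp [cr]

theorem cr_eq_one {e f : Sym2 ℕ} : cr e f = 1 ↔ ChordCross e f := by
  simp [cr]

theorem chordCross_of_lt {a b c d : ℕ} (hab : a < b) (hcd : c < d) :
    ChordCross s(a, b) s(c, d) ↔ (a < c ∧ c < b ∧ b < d) ∨ (c < a ∧ a < d ∧ d < b) := by
  rw [chordCross_mk]
  omega

theorem cr_uncross_le_of_lt {p q r t : ℕ} (hpq : p < q) (hqr : q < r) (hrt : r < t)
    (g : Sym2 ℕ) :
    cr g s(p, q) + cr g s(r, t) ≤ cr g s(p, r) + cr g s(q, t) ∧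
    cr g s(p, t) + cr g s(q, r) ≤ cr g s(p, r) + cr g s(q, t) := by
  induction g with | _ x y
  wlog hxy : x ≤ y generalizing x y
  · rw [Sym2.eq_swap (a := x)]
    exact this y x (by omega)
  rcases hxy.eq_or_lt with rfl | hxy
  · have : ∀ e, cr s(x, x) e = 0 := by
      intro e
      induction e with | _ a b
      rw [cr_eq_zero, chordCross_mk]
      omega
    simp [this]
  simp only [cr, chordCross_of_lt hxy hpq, chordCross_of_lt hxy hqr, chordCross_of_lt hxy hrt,
    chordCross_of_lt hxy (hpq.trans hqr), chordCross_of_lt hxy (hqr.trans hrt),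
    chordCross_of_lt hxy ((hpq.trans hqr).trans hrt)]
  constructor <;> split_ifs <;> omega

/-- Replacing two crossing chords by a noncrossing pair on the same four endpoints
does not create crossings with a third chord. -/
theorem cr_uncross_le {a b c d : ℕ} (h : ChordCross s(a, b) s(c, d)) (g : Sym2 ℕ) :
    cr g s(a, c) + cr g s(b, d) ≤ cr g s(a, b) + cr g s(c, d) := by
  wlog h1 : a < b ∧ a < c ∧ a < d generalizing a b c d
  · by_cases h2 : b < a ∧ b < c ∧ b < d
    · have := @this b a d c (by simpa only [Sym2.eq_swap] using h) ⟨h2.1, h2.2.2, h2.2.1⟩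
      simp only [Sym2.eq_swap (a := b) (b := a), Sym2.eq_swap (a := d) (b := c)] at this
      omega
    by_cases h3 : c < d ∧ c < a ∧ c < b
    · have := @this c d a b h.symm h3
      simp only [Sym2.eq_swap (a := c) (b := a), Sym2.eq_swap (a := d) (b := b)] at this
      omega
    · have h4 : d < c ∧ d < b ∧ d < a := by
        rw [chordCross_mk] at h
        omega
      have := @this d c b a (by simpa only [Sym2.eq_swap] using h.symm) h4
      simp only [Sym2.eq_swap (a := d), Sym2.eq_swap (a := c) (b := a),
        Sym2.eq_swap (a := b) (b := a)] at this
      omega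
  obtain ⟨hab, hac, had⟩ := h1
  rcases lt_or_ge c d with hcd | hcd
  · rw [chordCross_of_lt hab hcd] at h
    have := (cr_uncross_le_of_lt hac (show c < b by omega) (show b < d by omega) g).1
    omega
  · have hcd : d < c := lt_of_le_of_ne hcd (by rintro rfl; rw [chordCross_mk] at h; omega)
    rw [Sym2.eq_swap (a := c), chordCross_of_lt hab hcd] at h
    have := (cr_uncross_le_of_lt had (show d < b by omega) (show b < c by omega) g).2
    rw [Sym2.eq_swap (a := b) (b := d), Sym2.eq_swap (a := c) (b := d)]
    omega

theorem not_chordCross_uncross {a b c d : ℕ} (h : ChordCross s(a, b) s(c, d)) :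
    ¬ ChordCross s(a, c) s(b, d) := by
  simp only [chordCross_mk] at *
  omega

/-- The number of crossing pairs between two families of chords. -/
def mutualCr (E F : Multiset (Sym2 ℕ)) : ℕ := (E.map fun e => (F.map (cr e)).sum).sum

/-- Twice the number of crossings inside a family of chords. -/
def selfCr (E : Multiset (Sym2 ℕ)) : ℕ := mutualCr E E

theorem mutualCr_add_left (E E' F : Multiset (Sym2 ℕ)) :
    mutualCr (E + E') F = mutualCr E F + mutualCr E' F := by
  simp [mutualCr]

theorem mutualCr_comm (E F : Multiset (Sym2 ℕ)) : mutualCr E F = mutualCr F E := by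
  unfold mutualCr
  rw [Multiset.sum_map_sum_map]
  simp only [cr_comm]

theorem mutualCr_add_right (E F F' : Multiset (Sym2 ℕ)) :
    mutualCr E (F + F') = mutualCr E F + mutualCr E F' := by
  rw [mutualCr_comm, mutualCr_add_left, mutualCr_comm F, mutualCr_comm F']

theorem selfCr_add (E F : Multiset (Sym2 ℕ)) :
    selfCr (E + F) = selfCr E + 2 * mutualCr E F + selfCr F := by
  simp only [selfCr, mutualCr_add_left, mutualCr_add_right, mutualCr_comm F E]
  ring

theorem selfCr_add_pair (G : Multiset (Sym2 ℕ)) (e f : Sym2 ℕ) :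
    selfCr (G + {e, f}) = selfCr G + 2 * (G.map fun h => cr h e + cr h f).sum + 2 * cr e f := by
  rw [selfCr_add]
  simp [selfCr, mutualCr, cr_self, cr_comm f e]
  ring

theorem mutualCr_eq_zero {E F : Multiset (Sym2 ℕ)} :
    mutualCr E F = 0 ↔ ∀ e ∈ E, ∀ f ∈ F, ¬ ChordCross e f := by
  simp [mutualCr, Multiset.sum_eq_zero_iff, cr_eq_zero]

theorem selfCr_uncross {a b c d : ℕ} (h : ChordCross s(a, b) s(c, d)) (G : Multiset (Sym2 ℕ)) :
    selfCr (G + {s(a, c), s(b, d)}) + 2 ≤ selfCr (G + {s(a, b), s(c, d)}) := by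
  rw [selfCr_add_pair, selfCr_add_pair, cr_eq_one.2 h, cr_eq_zero.2 (not_chordCross_uncross h)]
  have := Multiset.sum_map_le_sum_map (s := G) (fun g => cr g s(a, c) + cr g s(b, d))
    (fun g => cr g s(a, b) + cr g s(c, d)) (fun g _ => cr_uncross_le h g)
  omega

/-- If uncrossing removes only one crossing, every other chord keeps its number of crossings
with the modified pair. -/
theorem cr_le_of_selfCr_uncross {a b c d : ℕ} (h : ChordCross s(a, b) s(c, d))
    {G : Multiset (Sym2 ℕ)}
    (hG : selfCr (G + {s(a, b), s(c, d)}) ≤ selfCr (G + {s(a, c), s(b, d)}) + 2)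
    {g : Sym2 ℕ} (hg : g ∈ G) :
    cr g s(a, b) + cr g s(c, d) ≤ cr g s(a, c) + cr g s(b, d) := by
  obtain ⟨G', rfl⟩ := Multiset.exists_cons_of_mem hg
  rw [selfCr_add_pair, selfCr_add_pair, cr_eq_one.2 h,
    cr_eq_zero.2 (not_chordCross_uncross h)] at hG
  have := Multiset.sum_map_le_sum_map (s := G') (fun g => cr g s(a, c) + cr g s(b, d))
    (fun g => cr g s(a, b) + cr g s(c, d)) (fun g _ => cr_uncross_le h g)
  simp only [Multiset.map_cons, Multiset.sum_cons] at hG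
  omega

/-- The edges of a walk given by its list of vertices. -/
def walkEdges : List ℕ → Multiset (Sym2 ℕ)
  | [] => 0
  | [_] => 0
  | x :: y :: t => s(x, y) ::ₘ walkEdges (y :: t)

/-- The edges of the closed walk given by its list of vertices. -/
def closedEdges (l : List ℕ) : Multiset (Sym2 ℕ) := walkEdges (l ++ l.take 1)

/-- The list `l` starts with `a` and ends with `b`. -/
structure Ends (l : List ℕ) (a b : ℕ) : Prop where
  head : l.head? = some a
  last : l.getLast? = some b

theorem exists_ends {l : List ℕ} (h : l ≠ []) : ∃ a b, Ends l a b :=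
  ⟨l.head h, l.getLast h, List.head?_eq_some_head h, List.getLast?_eq_some_getLast h⟩

theorem Ends.ne_nil {l : List ℕ} {a b : ℕ} (h : Ends l a b) : l ≠ [] := by
  rintro rfl
  simpa using h.head

theorem Ends.left_mem {l : List ℕ} {a b : ℕ} (h : Ends l a b) : a ∈ l :=
  List.mem_of_mem_head? h.head

theorem Ends.right_mem {l : List ℕ} {a b : ℕ} (h : Ends l a b) : b ∈ l :=
  List.mem_of_mem_getLast? h.last

theorem Ends.append {A B : List ℕ} {a a' b b' : ℕ} (hA : Ends A a a') (hB : Ends B b b') :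
    Ends (A ++ B) a b' :=
  ⟨by simp [List.head?_append, hA.head], by simp [List.getLast?_append, hB.last]⟩

theorem Ends.reverse {l : List ℕ} {a b : ℕ} (h : Ends l a b) : Ends l.reverse b a :=
  ⟨by simp [h.last], by simp [h.head]⟩

theorem ends_singleton (a : ℕ) : Ends [a] a a := ⟨rfl, rfl⟩

theorem Ends.exists_cons {l : List ℕ} {a b : ℕ} (h : Ends l a b) : ∃ t, l = a :: t := by
  cases l with
  | nil => exact absurd rfl h.ne_nil
  | cons x t => exact ⟨t, by simpa using h.head⟩

theorem walkEdges_append {A B : List ℕ} {a a' b b' : ℕ} (hA : Ends A a a') (hB : Ends B b b') :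
    walkEdges (A ++ B) = walkEdges A + walkEdges B + {s(a', b)} := by
  induction A generalizing a with
  | nil => exact absurd rfl hA.ne_nil
  | cons x t ih =>
    cases t with
    | nil =>
      obtain ⟨t', rfl⟩ := hB.exists_cons
      have : x = a' := by simpa using hA.last
      subst this
      simp only [walkEdges, List.cons_append, List.nil_append, Multiset.zero_add]
      rw [← Multiset.singleton_add, add_comm]
    | cons y t =>
      have := @ih y ⟨rfl, by simpa using hA.last⟩
      simp only [List.cons_append, walkEdges] at this ⊢
      rw [this]
      simp [Multiset.cons_add]

theorem closedEdges_eq {l : List ℕ} {a b : ℕ} (h : Ends l a b) :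
    closedEdges l = walkEdges l + {s(b, a)} := by
  have : l.take 1 = [a] := by
    obtain ⟨t, rfl⟩ := h.exists_cons
    simp
  rw [closedEdges, this, walkEdges_append h (ends_singleton a)]
  simp [walkEdges]

theorem closedEdges_append {A B : List ℕ} {a a' b b' : ℕ} (hA : Ends A a a')
    (hB : Ends B b b') :
    closedEdges (A ++ B) = walkEdges A + walkEdges B + {s(a', b), s(b', a)} := by
  rw [closedEdges_eq (hA.append hB), walkEdges_append hA hB, add_assoc]
  rfl

theorem closedEdges_append_comm (A B : List ℕ) : closedEdges (A ++ B) = closedEdges (B ++ A) := by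
  by_cases hA : A = []
  · simp [hA]
  by_cases hB : B = []
  · simp [hB]
  obtain ⟨a, a', hA⟩ := exists_ends hA
  obtain ⟨b, b', hB⟩ := exists_ends hB
  rw [closedEdges_append hA hB, closedEdges_append hB hA, add_comm (walkEdges A),
    Multiset.pair_comm]

theorem walkEdges_reverse (l : List ℕ) : walkEdges l.reverse = walkEdges l := by
  induction l with
  | nil => rfl
  | cons x t ih =>
    cases t with
    | nil => rfl
    | cons y t =>
      obtain ⟨b, hb⟩ : ∃ b, Ends (y :: t) y b := by
        obtain ⟨a, b, h⟩ := exists_ends (List.cons_ne_nil y t)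
        have : y = a := by simpa using h.head
        exact ⟨b, this ▸ h⟩
      rw [List.reverse_cons, walkEdges_append hb.reverse (ends_singleton x), ih, Sym2.eq_swap]
      simp only [walkEdges, add_zero]
      rw [← Multiset.singleton_add, add_comm]

theorem closedEdges_reverse (l : List ℕ) : closedEdges l.reverse = closedEdges l := by
  by_cases hl : l = []
  · simp [hl]
  obtain ⟨a, b, h⟩ := exists_ends hl
  rw [closedEdges_eq h, closedEdges_eq h.reverse, walkEdges_reverse, Sym2.eq_swap]

theorem mem_of_mem_walkEdges {l : List ℕ} {x y : ℕ} (h : s(x, y) ∈ walkEdges l) :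
    x ∈ l ∧ y ∈ l := by
  induction l with
  | nil => simp [walkEdges] at h
  | cons z t ih =>
    cases t with
    | nil => simp [walkEdges] at h
    | cons u t =>
      rw [walkEdges, Multiset.mem_cons, Sym2.eq_iff] at h
      rcases h with (⟨rfl, rfl⟩ | ⟨rfl, rfl⟩) | h
      · simp
      · simp
      · have := ih h
        exact ⟨List.mem_cons_of_mem _ this.1, List.mem_cons_of_mem _ this.2⟩

theorem mem_of_mem_closedEdges {l : List ℕ} {x y : ℕ} (h : s(x, y) ∈ closedEdges l) :
    x ∈ l ∧ y ∈ l := by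
  have h' := mem_of_mem_walkEdges h
  have : ∀ z, z ∈ l ++ l.take 1 → z ∈ l := fun z hz =>
    (List.mem_append.1 hz).elim id List.mem_of_mem_take
  exact ⟨this x h'.1, this y h'.2⟩

theorem card_walkEdges_cons (x : ℕ) (t : List ℕ) : (walkEdges (x :: t)).card = t.length := by
  induction t generalizing x with
  | nil => rfl
  | cons y t ih => simp [walkEdges, ih]

theorem card_closedEdges (l : List ℕ) : (closedEdges l).card = l.length := by
  cases l with
  | nil => rfl
  | cons x t => simp [closedEdges, card_walkEdges_cons]

theorem exists_append_of_mem_walkEdges {l : List ℕ} {e : Sym2 ℕ} (h : e ∈ walkEdges l) :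
    ∃ A B a a' b b', l = A ++ B ∧ Ends A a a' ∧ Ends B b b' ∧ e = s(a', b) := by
  induction l with
  | nil => simp [walkEdges] at h
  | cons x t ih =>
    cases t with
    | nil => simp [walkEdges] at h
    | cons y t =>
      rw [walkEdges, Multiset.mem_cons] at h
      rcases h with rfl | h
      · obtain ⟨b, b', hb⟩ := exists_ends (List.cons_ne_nil y t)
        have : y = b := by simpa using hb.head
        subst this
        exact ⟨[x], y :: t, x, x, y, b', rfl, ends_singleton x, hb, rfl⟩
      · obtain ⟨A, B, a, a', b, b', h1, h2, h3, h4⟩ := ih h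
        refine ⟨x :: A, B, x, a', b, b', by simp [h1], ?_, h3, h4⟩
        simpa using (ends_singleton x).append h2

theorem exists_rotation_of_mem_closedEdges {l : List ℕ} {e : Sym2 ℕ} (h : e ∈ closedEdges l) :
    ∃ l' a b, Ends l' a b ∧ l'.Perm l ∧ closedEdges l' = closedEdges l ∧ e = s(b, a) := by
  have hl : l ≠ [] := by
    rintro rfl
    simp [closedEdges, walkEdges] at h
  obtain ⟨a, b, hab⟩ := exists_ends hl
  rw [closedEdges_eq hab, Multiset.mem_add, Multiset.mem_singleton] at h
  rcases h with h | rfl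
  · obtain ⟨A, B, a, a', b, b', rfl, hA, hB, rfl⟩ := exists_append_of_mem_walkEdges h
    exact ⟨B ++ A, b, a', hB.append hA, List.perm_append_comm, closedEdges_append_comm _ _, rfl⟩
  · exact ⟨l, a, b, hab, List.Perm.refl _, rfl, rfl⟩

theorem exists_ends_of_mem_closedEdges {l : List ℕ} {x y : ℕ} (h : s(x, y) ∈ closedEdges l) :
    ∃ l', Ends l' x y ∧ l'.Perm l ∧ closedEdges l' = closedEdges l := by
  obtain ⟨l', a, b, h1, h2, h3, h4⟩ := exists_rotation_of_mem_closedEdges h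
  rw [Sym2.eq_iff] at h4
  rcases h4 with ⟨rfl, rfl⟩ | ⟨rfl, rfl⟩
  · exact ⟨l'.reverse, h1.reverse, (List.reverse_perm l').trans h2,
      (closedEdges_reverse l').trans h3⟩
  · exact ⟨l', h1, h2, h3⟩

theorem exists_append_of_mem_closedEdges {l : List ℕ} {e f : Sym2 ℕ} (he : e ∈ closedEdges l)
    (hf : f ∈ closedEdges l) (hef : e ≠ f) :
    ∃ A B a a' b b', Ends A a a' ∧ Ends B b b' ∧ (A ++ B).Perm l ∧
      closedEdges (A ++ B) = closedEdges l ∧ e = s(a', b) ∧ f = s(b', a) := by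
  obtain ⟨l', x, y, h1, h2, h3, rfl⟩ := exists_rotation_of_mem_closedEdges hf
  rw [← h3, closedEdges_eq h1, Multiset.mem_add, Multiset.mem_singleton] at he
  obtain ⟨A, B, a, a', b, b', rfl, hA, hB, rfl⟩ :=
    exists_append_of_mem_walkEdges (he.resolve_right hef)
  have ha := (hA.append hB).head
  have hb := (hA.append hB).last
  rw [h1.head, Option.some_inj] at ha
  rw [h1.last, Option.some_inj] at hb
  subst ha hb
  exact ⟨A, B, _, a', b, _, hA, hB, h2, h3, rfl, rfl⟩

theorem exists_mem_walkEdges_of_ends {Q : ℕ → Prop} {l : List ℕ} {a b : ℕ} (h : Ends l a b)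
    (ha : Q a) (hb : ¬ Q b) : ∃ x y, s(x, y) ∈ walkEdges l ∧ Q x ∧ ¬ Q y := by
  induction l generalizing a with
  | nil => exact absurd rfl h.ne_nil
  | cons x t ih =>
    have hx : x = a := by simpa using h.head
    subst hx
    cases t with
    | nil =>
      have hx : x = b := by simpa using h.last
      exact absurd ha (hx ▸ hb)
    | cons y t =>
      by_cases hy : Q y
      · obtain ⟨u, v, h1, h2⟩ := @ih y ⟨rfl, by simpa using h.last⟩ hy
        exact ⟨u, v, by simp [walkEdges, h1], h2⟩
      · exact ⟨x, y, by simp [walkEdges], ha, hy⟩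

theorem exists_mem_closedEdges_of_mem {Q : ℕ → Prop} {l : List ℕ} {a b : ℕ} (ha : a ∈ l)
    (hb : b ∈ l) (hQa : Q a) (hQb : ¬ Q b) : ∃ x y, s(x, y) ∈ closedEdges l ∧ Q x ∧ ¬ Q y := by
  obtain ⟨s, t, rfl⟩ := List.append_of_mem ha
  have hab : a ≠ b := fun h => hQb (h ▸ hQa)
  have hb' : b ∈ t ++ s := by
    simp only [List.mem_append, List.mem_cons] at hb ⊢
    rcases hb with h | h | h
    · exact Or.inr h
    · exact absurd h.symm hab
    · exact Or.inl h
  rw [closedEdges_append_comm]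
  obtain ⟨u, v, huv⟩ := List.append_of_mem hb'
  have h1 : a :: t ++ s = (a :: u ++ [b]) ++ v := by simp [huv]
  rw [h1]
  have hE : Ends (a :: u ++ [b]) a b := ⟨rfl, List.getLast?_concat⟩
  obtain ⟨x, y, h2, h3⟩ := exists_mem_walkEdges_of_ends hE hQa hQb
  refine ⟨x, y, ?_, h3⟩
  by_cases hv : v = []
  · rw [hv, List.append_nil, closedEdges_eq hE]
    exact Multiset.mem_add.2 (Or.inl h2)
  · obtain ⟨c, d, hcd⟩ := exists_ends hv
    rw [closedEdges_append hE hcd]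
    exact Multiset.mem_add.2 (Or.inl (Multiset.mem_add.2 (Or.inl h2)))

/-- The two endpoints of an edge have different colors. -/
def Bi (χ : ℕ → Bool) (e : Sym2 ℕ) : Prop := ∃ a ∈ e, ∃ b ∈ e, χ a ≠ χ b

theorem bi_mk {χ : ℕ → Bool} {a b : ℕ} : Bi χ s(a, b) ↔ χ a ≠ χ b := by
  simp only [Bi, Sym2.mem_iff]
  constructor
  · rintro ⟨x, rfl | rfl, y, rfl | rfl, h⟩ <;> first | exact h | exact h.symm | exact absurd rfl h
  · exact fun h => ⟨a, Or.inl rfl, b, Or.inr rfl, h⟩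

/-- The closed walk `l` alternates between the two colors. -/
def Alternating (χ : ℕ → Bool) (l : List ℕ) : Prop := ∀ e ∈ closedEdges l, Bi χ e

/-- The number of color changes along the closed walk `l`. -/
def colorChanges (χ : ℕ → Bool) (l : List ℕ) : ℕ := (closedEdges l).countP (Bi χ)

theorem Alternating.ends_ne {χ : ℕ → Bool} {l : List ℕ} {a b : ℕ} (h : Alternating χ l)
    (hab : Ends l a b) : χ b ≠ χ a :=
  bi_mk.1 (h _ (by rw [closedEdges_eq hab]; simp))

theorem Ends.le_of_pairwise {l : List ℕ} {a b x : ℕ} (h : Ends l a b) (hl : l.Pairwise (· < ·))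
    (hx : x ∈ l) : a ≤ x ∧ x ≤ b := by
  constructor
  · obtain ⟨t, rfl⟩ := h.exists_cons
    rcases List.mem_cons.1 hx with rfl | hx
    · exact le_rfl
    · exact (List.rel_of_pairwise_cons hl hx).le
  · obtain ⟨t, ht⟩ := h.reverse.exists_cons
    have hl' : (b :: t).Pairwise (· > ·) := by
      rw [← ht, List.pairwise_reverse]
      exact hl
    have hx' : x ∈ b :: t := by
      rw [← ht]
      exact List.mem_reverse.2 hx
    rcases List.mem_cons.1 hx' with rfl | hx'
    · exact le_rfl
    · exact (List.rel_of_pairwise_cons hl' hx').le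

/-- The increasing list `w`, read cyclically, splits into two arcs `u` (from `α` to `α'`) and
`v` (from `β` to `β'`), which are the cyclic readings of the increasing lists `wA` and `wB`. -/
structure CircSplit (w wA wB u v : List ℕ) (α α' β β' : ℕ) : Prop where
  pairwise_left : wA.Pairwise (· < ·)
  pairwise_right : wB.Pairwise (· < ·)
  ends_left : Ends u α α'
  ends_right : Ends v β β'
  perm_left : u.Perm wA
  perm_right : v.Perm wB
  perm : (wA ++ wB).Perm w
  closedEdges_left : closedEdges wA = closedEdges u
  closedEdges_right : closedEdges wB = closedEdges v
  closedEdges : closedEdges w = closedEdges (u ++ v)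
  gap_left : ∀ x ∈ wA, x ≠ α → x ≠ α' → ∀ y ∈ wB, ChordCross s(α', α) s(x, y)
  gap_right : ∀ x ∈ wB, x ≠ β → x ≠ β' → ∀ y ∈ wA, ChordCross s(β', β) s(x, y)
  not_cross_left : ∀ x ∈ wA, ∀ y ∈ wA,
    ¬ ChordCross s(x, y) s(α', β') ∧ ¬ ChordCross s(x, y) s(β, α)
  not_cross_right : ∀ x ∈ wB, ∀ y ∈ wB,
    ¬ ChordCross s(x, y) s(α', β') ∧ ¬ ChordCross s(x, y) s(β, α)
  cross : α ≠ α' → β ≠ β' → ChordCross s(α', β') s(β, α)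
  not_cross : ∀ x ∈ wA, ∀ y ∈ wA, ∀ z ∈ wB, ∀ t ∈ wB, ¬ ChordCross s(x, y) s(z, t)

theorem CircSplit.symm {w wA wB u v : List ℕ} {α α' β β' : ℕ}
    (h : CircSplit w wA wB u v α α' β β') : CircSplit w wB wA v u β β' α α' where
  pairwise_left := h.pairwise_right
  pairwise_right := h.pairwise_left
  ends_left := h.ends_right
  ends_right := h.ends_left
  perm_left := h.perm_right
  perm_right := h.perm_left
  perm := List.perm_append_comm.trans h.perm
  closedEdges_left := h.closedEdges_right
  closedEdges_right := h.closedEdges_left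
  closedEdges := h.closedEdges.trans (closedEdges_append_comm _ _)
  gap_left := h.gap_right
  gap_right := h.gap_left
  not_cross_left x hx y hy := by
    rw [Sym2.eq_swap (a := β'), Sym2.eq_swap (a := α)]
    exact h.not_cross_right x hx y hy
  not_cross_right x hx y hy := by
    rw [Sym2.eq_swap (a := β'), Sym2.eq_swap (a := α)]
    exact h.not_cross_left x hx y hy
  cross h1 h2 := by
    rw [Sym2.eq_swap (a := β'), Sym2.eq_swap (a := α)]
    exact h.cross h2 h1
  not_cross x hx y hy z hz t ht hc := h.not_cross z hz t ht x hx y hy hc.symm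

theorem circSplit_of_append {w₁ v w₂ : List ℕ} {α α' β β' : ℕ}
    (hw : (w₁ ++ v ++ w₂).Pairwise (· < ·)) (hv : Ends v β β') (hu : Ends (w₂ ++ w₁) α α') :
    CircSplit (w₁ ++ v ++ w₂) (w₁ ++ w₂) v (w₂ ++ w₁) v α α' β β' := by
  have hA : (w₁ ++ w₂).Pairwise (· < ·) :=
    hw.sublist (List.Sublist.append_right (List.sublist_append_left _ _) _)
  have hB : v.Pairwise (· < ·) :=
    hw.sublist ((List.sublist_append_right w₁ v).trans (List.sublist_append_left _ _))
  have hvb : ∀ b ∈ v, β ≤ b ∧ b ≤ β' := fun b hb => hv.le_of_pairwise hB hb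
  obtain ⟨hw1, hw2, hw3⟩ := List.pairwise_append.1 hw
  obtain ⟨hw4, hw5, hw6⟩ := List.pairwise_append.1 hw1
  have h1 : ∀ x ∈ w₁, x < β := fun x hx => hw6 x hx β hv.left_mem
  have h2 : ∀ x ∈ w₂, β' < x := fun x hx =>
    hw3 β' (List.mem_append_right _ hv.right_mem) x hx
  have hβ : β ≤ β' := (hvb β hv.left_mem).2
  have key : (α ≤ α' ∧ β' < α ∧ ∀ x ∈ w₁ ++ w₂, α ≤ x ∧ x ≤ α') ∨
      (α ≤ α' ∧ α' < β ∧ ∀ x ∈ w₁ ++ w₂, α ≤ x ∧ x ≤ α') ∨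
      (α' < β ∧ β' < α ∧ ∀ x ∈ w₁ ++ w₂, x ≤ α' ∨ α ≤ x) := by
    by_cases e1 : w₁ = []
    · subst e1
      simp only [List.append_nil, List.nil_append] at hu hA ⊢
      have := fun x hx => hu.le_of_pairwise hA (x := x) hx
      exact Or.inl ⟨(this α hu.left_mem).2, h2 α hu.left_mem, this⟩
    by_cases e2 : w₂ = []
    · subst e2
      simp only [List.append_nil, List.nil_append] at hu hA ⊢
      have := fun x hx => hu.le_of_pairwise hA (x := x) hx
      exact Or.inr (Or.inl ⟨(this α hu.left_mem).2, h1 α' hu.right_mem, this⟩)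
    obtain ⟨a, a', ha⟩ := exists_ends e1
    obtain ⟨c, c', hc⟩ := exists_ends e2
    have e3 := (hc.append ha).head
    have e4 := (hc.append ha).last
    rw [hu.head, Option.some_inj] at e3
    rw [hu.last, Option.some_inj] at e4
    subst e3 e4
    refine Or.inr (Or.inr ⟨h1 _ ha.right_mem, h2 _ hc.left_mem, fun x hx => ?_⟩)
    rcases List.mem_append.1 hx with hx | hx
    · exact Or.inl (ha.le_of_pairwise hw4 hx).2
    · exact Or.inr (hc.le_of_pairwise hw2 hx).1
  have hrot : closedEdges (w₁ ++ v ++ w₂) = closedEdges (w₂ ++ w₁ ++ v) := by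
    rw [closedEdges_append_comm, List.append_assoc]
  refine ⟨hA, hB, hu, hv, List.perm_append_comm, List.Perm.refl _, ?_,
    closedEdges_append_comm _ _, rfl, hrot, ?_, ?_, ?_, ?_, ?_, ?_⟩
  · rw [List.append_assoc, List.append_assoc]
    exact List.Perm.append_left _ List.perm_append_comm
  · intro x hx hxα hxα' y hy
    have := hvb y hy
    rw [chordCross_mk]
    rcases key with ⟨k1, k2, k3⟩ | ⟨k1, k2, k3⟩ | ⟨k1, k2, k3⟩ <;> have := k3 x hx <;> omega
  · intro x hx hxβ hxβ' y hy
    have := hvb x hx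
    rw [chordCross_mk]
    rcases List.mem_append.1 hy with hy | hy
    · have := h1 y hy
      omega
    · have := h2 y hy
      omega
  · intro x hx y hy
    rw [chordCross_mk, chordCross_mk]
    rcases key with ⟨k1, k2, k3⟩ | ⟨k1, k2, k3⟩ | ⟨k1, k2, k3⟩ <;>
      have := k3 x hx <;> have := k3 y hy <;> omega
  · intro x hx y hy
    have := hvb x hx
    have := hvb y hy
    rw [chordCross_mk, chordCross_mk]
    rcases key with ⟨k1, k2, k3⟩ | ⟨k1, k2, k3⟩ | ⟨k1, k2, k3⟩ <;> omega
  · intro h1 h2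
    rw [chordCross_mk]
    rcases key with ⟨k1, k2, k3⟩ | ⟨k1, k2, k3⟩ | ⟨k1, k2, k3⟩ <;> omega
  · intro x hx y hy z hz t ht
    have := hvb z hz
    have := hvb t ht
    rw [chordCross_mk]
    rcases List.mem_append.1 hx with hx | hx <;> rcases List.mem_append.1 hy with hy | hy
    · have := h1 x hx
      have := h1 y hy
      omega
    · have := h1 x hx
      have := h2 y hy
      omega
    · have := h2 x hx
      have := h1 y hy
      omega
    · have := h2 x hx
      have := h2 y hy
      omega

/-- A partition of an increasing list into two non-interleaving parts is a splitting
into two arcs. -/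
theorem exists_circSplit {w A B : List ℕ} (hw : w.Pairwise (· < ·)) (hAB : (A ++ B).Perm w)
    (hA : A ≠ []) (hB : B ≠ [])
    (h1 : ∀ a ∈ A, ∀ b ∈ B, ∀ c ∈ A, ∀ d ∈ B, a < b → b < c → c < d → False)
    (h2 : ∀ a ∈ B, ∀ b ∈ A, ∀ c ∈ B, ∀ d ∈ A, a < b → b < c → c < d → False) :
    ∃ wA wB u v α α' β β', CircSplit w wA wB u v α α' β β' ∧ wA.Perm A ∧ wB.Perm B := by
  obtain ⟨m, m', hm⟩ : ∃ m m', Ends w m m' := by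
    refine exists_ends ?_
    rintro rfl
    simp_all
  wlog hmA : m ∈ A generalizing A B
  · have hmB : m ∈ B := (List.mem_append.1 (hAB.mem_iff.2 hm.left_mem)).resolve_left hmA
    obtain ⟨wA, wB, u, v, α, α', β, β', h, h3, h4⟩ :=
      this (List.perm_append_comm.trans hAB) hB hA h2 h1 hmB
    exact ⟨wB, wA, v, u, β, β', α, α', h.symm, h4, h3⟩
  have hwn : w.Nodup := hw.imp fun h => h.ne
  have hABn : (A ++ B).Nodup := hAB.nodup_iff.2 hwn
  obtain ⟨hAn, hBn, hdis⟩ := List.nodup_append.1 hABn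
  have hmemw : ∀ x, x ∈ w ↔ x ∈ A ∨ x ∈ B := fun x => by rw [← hAB.mem_iff, List.mem_append]
  have hmin : ∀ x ∈ w, m ≤ x := fun x hx => (hm.le_of_pairwise hw hx).1
  obtain ⟨β, β', hβ⟩ : ∃ β β', Ends (w.filter (· ∈ B)) β β' := by
    refine exists_ends ?_
    obtain ⟨x, hx⟩ := List.exists_mem_of_ne_nil B hB
    refine List.ne_nil_of_mem (a := x) ?_
    simp [hmemw, hx]
  have hβ' : ∀ x ∈ B, β ≤ x ∧ x ≤ β' := fun x hx =>
    hβ.le_of_pairwise (hw.filter _) (by simp [hmemw, hx])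
  have hβB : β ∈ B := by simpa using (List.mem_filter.1 hβ.left_mem).2
  have hβB' : β' ∈ B := by simpa using (List.mem_filter.1 hβ.right_mem).2
  have hmem : ∀ x, x ∈ w → (x ∈ B ↔ β ≤ x ∧ x ≤ β') := by
    refine fun x hx => ⟨hβ' x, fun h => ?_⟩
    by_contra hxB
    have hxA : x ∈ A := ((hmemw x).1 hx).resolve_right hxB
    have e1 : x ≠ β := fun h => hxB (h ▸ hβB)
    have e2 : x ≠ β' := fun h => hxB (h ▸ hβB')
    have e3 : m ≠ β := hdis m hmA β hβB
    have e4 := hmin β ((hmemw β).2 (Or.inr hβB))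
    exact h1 m hmA β hβB x hxA β' hβB' (by omega) (by omega) (by omega)
  set w₁ := w.filter (· < β) with hw₁
  set v := w.filter (fun x => β ≤ x ∧ x ≤ β') with hv
  set w₂ := w.filter (β' < ·) with hw₂
  have hββ := (hβ' β hβB).2
  have hsort : (w₁ ++ v ++ w₂).Pairwise (· < ·) := by
    refine List.pairwise_append.2 ⟨List.pairwise_append.2 ⟨hw.filter _, hw.filter _, ?_⟩,
      hw.filter _, ?_⟩
    · intro a ha b hb
      simp [hw₁, hv] at ha hb
      omega
    · intro a ha b hb
      simp [hw₁, hv, hw₂] at ha hb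
      omega
  have hwe : w₁ ++ v ++ w₂ = w := by
    refine List.Perm.eq_of_pairwise (fun a b _ _ h1 h2 => absurd h1 (by omega)) hsort hw ?_
    refine (List.perm_ext_iff_of_nodup (hsort.imp fun h => h.ne) hwn).2 fun x => ?_
    simp only [hw₁, hv, hw₂, List.mem_append, List.mem_filter, decide_eq_true_eq]
    constructor
    · tauto
    · intro hx
      simp only [hx, true_and]
      omega
  have hvB : v.Perm B := by
    refine (List.perm_ext_iff_of_nodup (hwn.filter _) hBn).2 fun x => ?_
    simp only [List.mem_filter, decide_eq_true_eq]
    constructor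
    · exact fun h => (hmem x h.1).2 h.2
    · exact fun h => ⟨(hmemw x).2 (Or.inr h), hβ' x h⟩
  have hwA : (w₁ ++ w₂).Perm A := by
    have hn : (w₁ ++ w₂).Nodup :=
      (hsort.imp fun h => h.ne).sublist
        (List.Sublist.append_right (List.sublist_append_left _ _) _)
    refine (List.perm_ext_iff_of_nodup hn hAn).2 fun x => ?_
    simp only [hw₁, hw₂, List.mem_append, List.mem_filter, decide_eq_true_eq]
    constructor
    · intro h
      have hx : x ∈ w := by tauto
      refine ((hmemw x).1 hx).resolve_right fun hxB => ?_
      have := hβ' x hxB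
      omega
    · intro h
      have hx : x ∈ w := (hmemw x).2 (Or.inl h)
      have : x ∉ B := fun hxB => hdis x h x hxB rfl
      rw [hmem x hx] at this
      simp only [hx, true_and]
      omega
  obtain ⟨b, b', hb⟩ := exists_ends (l := v) fun h => hB (by simpa [h] using hvB.symm)
  obtain ⟨a, a', ha⟩ := exists_ends (l := w₂ ++ w₁) fun h => hA (by
    have h' := (List.perm_append_comm (l₁ := w₂) (l₂ := w₁)).trans hwA
    rw [h] at h'
    simpa using h'.symm)
  have := circSplit_of_append hsort hb ha
  rw [hwe] at this
  exact ⟨_, _, _, _, a, a', b, b', this, hwA, hvB⟩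

/-- A cyclic gap of an increasing list is either free of elements of the list
or encloses all of them. -/
theorem gap_of_mem_closedEdges {w : List ℕ} (hw : w.Pairwise (· < ·)) {x y : ℕ}
    (h : s(x, y) ∈ closedEdges w) :
    (∀ z ∈ w, ¬ (x < z ∧ z < y) ∧ ¬ (y < z ∧ z < x)) ∨
    (∀ z ∈ w, x ≤ z ∧ z ≤ y) ∨ (∀ z ∈ w, y ≤ z ∧ z ≤ x) := by
  have hne : w ≠ [] := List.ne_nil_of_mem (mem_of_mem_closedEdges h).1
  obtain ⟨a, b, hab⟩ := exists_ends hne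
  rw [closedEdges_eq hab, Multiset.mem_add, Multiset.mem_singleton] at h
  rcases h with h | h
  · obtain ⟨A, B, a, a', b, b', rfl, hA, hB, h⟩ := exists_append_of_mem_walkEdges h
    obtain ⟨h1, h2, h3⟩ := List.pairwise_append.1 hw
    refine Or.inl fun z hz => ?_
    have h4 := h3 a' hA.right_mem b hB.left_mem
    have h5 : z ≤ a' ∨ b ≤ z := (List.mem_append.1 hz).imp
      (fun hz => (hA.le_of_pairwise h1 hz).2) (fun hz => (hB.le_of_pairwise h2 hz).1)
    rcases Sym2.eq_iff.1 h with ⟨rfl, rfl⟩ | ⟨rfl, rfl⟩ <;> omega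
  · rcases Sym2.eq_iff.1 h with ⟨rfl, rfl⟩ | ⟨rfl, rfl⟩
    · exact Or.inr (Or.inr fun z hz => hab.le_of_pairwise hw hz)
    · exact Or.inr (Or.inl fun z hz => hab.le_of_pairwise hw hz)

theorem not_chordCross_of_mem_closedEdges {w : List ℕ} (hw : w.Pairwise (· < ·)) {g : Sym2 ℕ}
    (h : g ∈ closedEdges w) {x y : ℕ} (hx : x ∈ w) (hy : y ∈ w) : ¬ ChordCross g s(x, y) := by
  induction g with | _ a b
  have ha := (mem_of_mem_closedEdges h).1
  have hb := (mem_of_mem_closedEdges h).2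
  rw [chordCross_mk]
  rcases gap_of_mem_closedEdges hw h with h | h | h <;>
    have := h x hx <;> have := h y hy <;> have := h a ha <;> have := h b hb <;> omega

theorem exists_chordCross_of_separated {l : List ℕ} {a b x p : ℕ} (h : Ends l a b) (hx : x ∉ l)
    (hp : p ∉ l)
    (hs : ((x < a ∧ a < p) ∨ (p < a ∧ a < x)) ↔ ¬ ((x < b ∧ b < p) ∨ (p < b ∧ b < x))) :
    ∃ e ∈ walkEdges l, ChordCross s(x, p) e := by
  wlog ha : (x < a ∧ a < p) ∨ (p < a ∧ a < x) generalizing a b l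
  · have := @this l.reverse b a h.reverse (by simpa using hx) (by simpa using hp) (by tauto)
      (by tauto)
    rwa [walkEdges_reverse] at this
  obtain ⟨u, v, h1, h2, h3⟩ := exists_mem_walkEdges_of_ends
    (Q := fun z => (x < z ∧ z < p) ∨ (p < z ∧ z < x)) h ha (hs.1 ha)
  have hv := (mem_of_mem_walkEdges h1).2
  have h4 : x ≠ v := fun h => hx (h ▸ hv)
  have h5 : p ≠ v := fun h => hp (h ▸ hv)
  refine ⟨_, h1, ?_⟩
  rw [chordCross_mk]
  omega

theorem not_interleaved {A B : List ℕ} (hdis : ∀ x ∈ A, x ∉ B)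
    (h : mutualCr (closedEdges A) (closedEdges B) = 0) :
    ∀ a ∈ A, ∀ b ∈ B, ∀ c ∈ A, ∀ d ∈ B, a < b → b < c → c < d → False := by
  intro a ha b hb c hc d hd hab hbc hcd
  obtain ⟨u, v, h1, h2, h3⟩ := exists_mem_closedEdges_of_mem (Q := fun z => a < z ∧ z < c) hb hd
    ⟨hab, hbc⟩ (by omega)
  obtain ⟨hu, hv⟩ := mem_of_mem_closedEdges h1
  have hav : a ≠ v := fun h => hdis a ha (h ▸ hv)
  have hcv : c ≠ v := fun h => hdis c hc (h ▸ hv)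
  obtain ⟨x, y, h4, h5, h6⟩ : ∃ x y, s(x, y) ∈ closedEdges A ∧
      ((u < x ∧ x < v) ∨ (v < x ∧ x < u)) ∧ ¬ ((u < y ∧ y < v) ∨ (v < y ∧ y < u)) := by
    rcases lt_or_gt_of_ne hav with hav | hav
    · exact exists_mem_closedEdges_of_mem (Q := fun x => (u < x ∧ x < v) ∨ (v < x ∧ x < u)) hc ha
        (by omega) (by omega)
    · exact exists_mem_closedEdges_of_mem (Q := fun x => (u < x ∧ x < v) ∨ (v < x ∧ x < u)) ha hc
        (by omega) (by omega)
  obtain ⟨hx, hy⟩ := mem_of_mem_closedEdges h4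
  have hyu : y ≠ u := fun h => hdis y hy (h ▸ hu)
  have hyv : y ≠ v := fun h => hdis y hy (h ▸ hv)
  refine mutualCr_eq_zero.1 h _ h4 _ h1 ?_
  rw [chordCross_mk]
  omega

theorem Ends.eq_singleton {l : List ℕ} {a : ℕ} (h : Ends l a a) (hl : l.Nodup) : l = [a] := by
  obtain ⟨t, rfl⟩ := h.exists_cons
  rcases t.eq_nil_or_concat with rfl | ⟨t, b, rfl⟩
  · rfl
  · have h1 := h.last
    rw [List.concat_eq_append, ← List.cons_append, List.getLast?_concat, Option.some_inj] at h1
    subst h1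
    simp at hl

theorem separated_of_gap {x y p q : ℕ} (hxy : x ≠ y) (hpx : p ≠ x) (hqx : q ≠ x) (hpy : p ≠ y)
    (hqy : q ≠ y) (hpq : p ≠ q)
    (h : (¬ (x < p ∧ p < y) ∧ ¬ (y < p ∧ p < x) ∧ ¬ (x < q ∧ q < y) ∧ ¬ (y < q ∧ q < x)) ∨
      (x ≤ p ∧ p ≤ y ∧ x ≤ q ∧ q ≤ y) ∨ (y ≤ p ∧ p ≤ x ∧ y ≤ q ∧ q ≤ x)) :
    (((x < y ∧ y < p) ∨ (p < y ∧ y < x)) ↔ ¬ ((x < q ∧ q < p) ∨ (p < q ∧ q < x))) ∨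
      (((x < p ∧ p < q) ∨ (q < p ∧ p < x)) ↔ ¬ ((x < y ∧ y < q) ∨ (q < y ∧ y < x))) := by
  by_cases s1 : (x < y ∧ y < p) ∨ (p < y ∧ y < x) <;>
  by_cases s2 : (x < q ∧ q < p) ∨ (p < q ∧ q < x) <;>
  by_cases s3 : (x < p ∧ p < q) ∨ (q < p ∧ p < x) <;>
  by_cases s4 : (x < y ∧ y < q) ∨ (q < y ∧ y < x) <;>
  first
  | exact Or.inl ⟨fun _ => s2, fun _ => s1⟩
  | exact Or.inl ⟨fun h => absurd h s1, fun h => absurd s2 h⟩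
  | exact Or.inr ⟨fun _ => s4, fun _ => s3⟩
  | exact Or.inr ⟨fun h => absurd h s3, fun h => absurd s4 h⟩
  | (exfalso
     rcases lt_or_gt_of_ne hxy with h1 | h1 <;> rcases lt_or_gt_of_ne hpq with h2 | h2 <;>
     rcases lt_or_gt_of_ne hpx with h3 | h3 <;> rcases lt_or_gt_of_ne hqx with h4 | h4 <;> omega)

/-- A Hamiltonian closed walk without crossings uses every gap between
cyclically consecutive points. -/
theorem exists_chordCross_of_gap_not_mem {w l : List ℕ} (hw : w.Pairwise (· < ·))
    (hl : l.Perm w) {g : Sym2 ℕ} (hg : g ∈ closedEdges w) (hgl : g ∉ closedEdges l) :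
    ∃ e ∈ closedEdges l, ∃ f ∈ closedEdges l, ChordCross e f := by
  induction g with | _ x y
  have hwn : w.Nodup := hw.imp fun h => h.ne
  obtain ⟨hx, hy⟩ := mem_of_mem_closedEdges hg
  by_cases hxy : x = y
  · subst hxy
    obtain ⟨w', h1, h2, h3⟩ := exists_ends_of_mem_closedEdges hg
    have h4 := h1.eq_singleton (h2.nodup_iff.2 hwn)
    subst h4
    have h5 : l = [x] := List.perm_singleton.1 (hl.trans h2.symm)
    subst h5
    rw [h3] at hgl
    exact absurd hg hgl
  obtain ⟨s, t, rfl⟩ := List.append_of_mem (hl.mem_iff.2 hx)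
  rw [closedEdges_append_comm] at hgl ⊢
  have hp : (x :: (t ++ s)).Perm w := by
    refine List.Perm.trans ?_ hl
    exact List.perm_append_comm (l₁ := x :: t) (l₂ := s)
  have hys : y ∈ t ++ s := by
    have := hp.mem_iff.2 hy
    rw [List.mem_cons] at this
    exact this.resolve_left fun h => hxy h.symm
  rw [List.cons_append] at hgl ⊢
  obtain ⟨P, Q, hPQ⟩ := List.append_of_mem hys
  rw [hPQ] at hp hgl ⊢
  have hn := hp.nodup_iff.2 hwn
  have hyQ : ∃ q, Ends (y :: Q) y q := by
    obtain ⟨a, q, h⟩ := exists_ends (List.cons_ne_nil y Q)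
    have : y = a := by simpa using h.head
    exact ⟨q, this ▸ h⟩
  obtain ⟨q, hq⟩ := hyQ
  by_cases hP : P = []
  · subst hP
    refine absurd ?_ hgl
    rw [List.nil_append, ← List.singleton_append, closedEdges_append (ends_singleton x) hq]
    simp
  obtain ⟨p, p', hpp⟩ := exists_ends hP
  have hE1 : closedEdges (x :: (P ++ y :: Q)) = walkEdges [x] + walkEdges (P ++ y :: Q) +
      {s(x, p), s(q, x)} := by
    rw [← List.singleton_append, closedEdges_append (ends_singleton x) (hpp.append hq)]
  have hE2 : walkEdges (P ++ y :: Q) = walkEdges P + walkEdges (y :: Q) + {s(p', y)} :=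
    walkEdges_append hpp hq
  have hE3 : walkEdges (P ++ [y]) = walkEdges P + walkEdges [y] + {s(p', y)} :=
    walkEdges_append hpp (ends_singleton y)
  have hqy : q ≠ y := by
    rintro rfl
    exact hgl (by rw [hE1]; simp [Sym2.eq_swap])
  have hm1 : s(x, p) ∈ closedEdges (x :: (P ++ y :: Q)) := by rw [hE1]; simp
  have hm2 : s(x, q) ∈ closedEdges (x :: (P ++ y :: Q)) := by
    rw [hE1, Sym2.eq_swap (a := x) (b := q)]
    simp
  have hpw : p ∈ w := hp.mem_iff.1 (by simp [hpp.left_mem])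
  have hqw : q ∈ w := hp.mem_iff.1 (List.mem_cons_of_mem _ (List.mem_append_right _ hq.right_mem))
  rw [List.nodup_cons, List.nodup_append] at hn
  obtain ⟨hn1, hn2, hn3, hn4⟩ := hn
  rw [List.mem_append, not_or] at hn1
  have hpQ : p ∉ y :: Q := fun h => hn4 p hpp.left_mem p h rfl
  have hqP : q ∉ P ++ [y] := by
    rw [List.mem_append, List.mem_singleton, not_or]
    exact ⟨fun h => hn4 q h q hq.right_mem rfl, hqy⟩
  have hxP : x ∉ P ++ [y] := by
    rw [List.mem_append, List.mem_singleton, not_or]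
    exact ⟨hn1.1, hxy⟩
  have hpy : p ≠ y := fun h => hpQ (by simp [h])
  have hpx : p ≠ x := fun h => hn1.1 (h ▸ hpp.left_mem)
  have hqx : q ≠ x := fun h => hn1.2 (h ▸ hq.right_mem)
  have hpq : p ≠ q := fun h => hpQ (h ▸ hq.right_mem)
  have hsep : (((x < y ∧ y < p) ∨ (p < y ∧ y < x)) ↔ ¬ ((x < q ∧ q < p) ∨ (p < q ∧ q < x))) ∨
      (((x < p ∧ p < q) ∨ (q < p ∧ p < x)) ↔ ¬ ((x < y ∧ y < q) ∨ (q < y ∧ y < x))) := by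
    have hgap : (¬ (x < p ∧ p < y) ∧ ¬ (y < p ∧ p < x) ∧ ¬ (x < q ∧ q < y) ∧ ¬ (y < q ∧ q < x)) ∨
        (x ≤ p ∧ p ≤ y ∧ x ≤ q ∧ q ≤ y) ∨ (y ≤ p ∧ p ≤ x ∧ y ≤ q ∧ q ≤ x) := by
      rcases gap_of_mem_closedEdges hw hg with h | h | h
      · exact Or.inl ⟨(h p hpw).1, (h p hpw).2, h q hqw⟩
      · exact Or.inr (Or.inl ⟨(h p hpw).1, (h p hpw).2, h q hqw⟩)
      · exact Or.inr (Or.inr ⟨(h p hpw).1, (h p hpw).2, h q hqw⟩)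
    exact separated_of_gap hxy hpx hqx hpy hqy hpq hgap
  rcases hsep with hs | hs
  · obtain ⟨e, h1, h2⟩ := exists_chordCross_of_separated hq hn1.2 hpQ hs
    refine ⟨_, hm1, e, ?_, h2⟩
    rw [hE1, hE2]
    simp [h1]
  · obtain ⟨e, h1, h2⟩ := exists_chordCross_of_separated (hpp.append (ends_singleton y)) hxP hqP hs
    refine ⟨_, hm2, e, ?_, h2⟩
    rw [hE1, hE2]
    rw [hE3] at h1
    simp only [walkEdges, add_zero, Multiset.mem_add] at h1 ⊢
    tauto

theorem selfCr_swap {a b c d : ℕ} (h : ChordCross s(a, b) s(c, d)) (G : Multiset (Sym2 ℕ)) :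
    selfCr (G + {s(a, d), s(b, c)}) + 2 ≤ selfCr (G + {s(a, b), s(c, d)}) := by
  rw [Sym2.eq_swap (a := c) (b := d)] at h ⊢
  exact selfCr_uncross h G

/-- Uncrossing two crossing edges of an alternating closed walk has split it into two
alternating closed walks `A` and `B` without mutual crossings. -/
structure UncrossedSplit (χ : ℕ → Bool) (w l A B wA wB u v : List ℕ) (e f : Sym2 ℕ)
    (a a' b b' α α' β β' : ℕ) : Prop where
  ends_left : Ends A a a'
  ends_right : Ends B b b'
  edge_left : e = s(a', b)
  edge_right : f = s(b', a)
  edges_eq : closedEdges l = closedEdges (A ++ B)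
  alternating_left : Alternating χ A
  alternating_right : Alternating χ B
  mutualCr_eq : mutualCr (closedEdges A) (closedEdges B) = 0
  circSplit : CircSplit w wA wB u v α α' β β'
  perm_left : A.Perm wA
  perm_right : B.Perm wB

theorem UncrossedSplit.symm {χ : ℕ → Bool} {w l A B wA wB u v : List ℕ} {e f : Sym2 ℕ}
    {a a' b b' α α' β β' : ℕ} (h : UncrossedSplit χ w l A B wA wB u v e f a a' b b' α α' β β') :
    UncrossedSplit χ w l B A wB wA v u f e b b' a a' β β' α α' where
  ends_left := h.ends_right
  ends_right := h.ends_left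
  edge_left := h.edge_right
  edge_right := h.edge_left
  edges_eq := h.edges_eq.trans (closedEdges_append_comm A B)
  alternating_left := h.alternating_right
  alternating_right := h.alternating_left
  mutualCr_eq := (mutualCr_comm _ _).trans h.mutualCr_eq
  circSplit := h.circSplit.symm
  perm_left := h.perm_right
  perm_right := h.perm_left

theorem alternating_append_iff {χ : ℕ → Bool} {A B : List ℕ} {a a' b b' : ℕ} (hA : Ends A a a')
    (hB : Ends B b b') : Alternating χ (A ++ B) ↔
      (∀ e ∈ walkEdges A, Bi χ e) ∧ (∀ e ∈ walkEdges B, Bi χ e) ∧ χ a' ≠ χ b ∧ χ b' ≠ χ a := by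
  simp only [Alternating, closedEdges_append hA hB, Multiset.mem_add, Multiset.insert_eq_cons,
    Multiset.mem_cons, Multiset.mem_singleton, or_imp, forall_and, forall_eq, bi_mk, and_assoc]

theorem alternating_iff {χ : ℕ → Bool} {A : List ℕ} {a a' : ℕ} (hA : Ends A a a') :
    Alternating χ A ↔ (∀ e ∈ walkEdges A, Bi χ e) ∧ χ a' ≠ χ a := by
  simp only [Alternating, closedEdges_eq hA, Multiset.mem_add,
    Multiset.mem_singleton, or_imp, forall_and, forall_eq, bi_mk]

/-- Two alternating closed walks having crossing edges can be merged into one,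
with fewer crossings. -/
theorem exists_merge {χ : ℕ → Bool} {A B : List ℕ} (hA : Alternating χ A) (hB : Alternating χ B)
    (h : mutualCr (closedEdges A) (closedEdges B) ≠ 0) :
    ∃ l, l.Perm (A ++ B) ∧ Alternating χ l ∧
      selfCr (closedEdges l) + 2 ≤ selfCr (closedEdges A + closedEdges B) := by
  rw [Ne, mutualCr_eq_zero] at h
  push Not at h
  obtain ⟨e, he, f, hf, hef⟩ := h
  obtain ⟨A', p, p', hp, hpA, hEA, rfl⟩ := exists_rotation_of_mem_closedEdges he
  obtain ⟨B', q, q', hq, hqB, hEB, rfl⟩ := exists_rotation_of_mem_closedEdges hf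
  have hA' : Alternating χ A' := by rwa [Alternating, hEA]
  have hB' : Alternating χ B' := by rwa [Alternating, hEB]
  rw [alternating_iff hp] at hA'
  rw [alternating_iff hq] at hB'
  have hsum : closedEdges A + closedEdges B =
      walkEdges A' + walkEdges B' + {s(p', p), s(q', q)} := by
    rw [← hEA, ← hEB, closedEdges_eq hp, closedEdges_eq hq, add_add_add_comm]
    rfl
  rw [hsum]
  by_cases hc : χ p' = χ q
  · refine ⟨A' ++ B'.reverse, ?_, ?_, ?_⟩
    · exact hpA.append ((List.reverse_perm B').trans hqB)
    · rw [alternating_append_iff hp hq.reverse, walkEdges_reverse]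
      exact ⟨hA'.1, hB'.1, fun h => hB'.2 (h.symm.trans hc), fun h => hA'.2 (hc.trans h)⟩
    · rw [closedEdges_append hp hq.reverse, walkEdges_reverse, Sym2.eq_swap (a := q)]
      exact selfCr_uncross hef _
  · refine ⟨A' ++ B', hpA.append hqB, ?_, ?_⟩
    · rw [alternating_append_iff hp hq]
      refine ⟨hA'.1, hB'.1, hc, fun h => ?_⟩
      have h1 := hA'.2
      have h2 := hB'.2
      revert hc h1 h2 h
      cases χ p <;> cases χ p' <;> cases χ q <;> cases χ q' <;> simp
    · rw [closedEdges_append hp hq, Sym2.eq_swap (a := q') (b := p)]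
      exact selfCr_swap hef _

theorem uncross_cases {χ : ℕ → Bool} {w l : List ℕ} (hw : w.Pairwise (· < ·)) (hl : l.Perm w)
    (halt : Alternating χ l) {e f : Sym2 ℕ} (he : e ∈ closedEdges l) (hf : f ∈ closedEdges l)
    (hef : ChordCross e f) :
    (∃ l', l'.Perm w ∧ Alternating χ l' ∧
      selfCr (closedEdges l') + 2 ≤ selfCr (closedEdges l)) ∨
    ∃ A B wA wB u v a a' b b' α α' β β',
      UncrossedSplit χ w l A B wA wB u v e f a a' b b' α α' β β' := by
  obtain ⟨A, B, a, a', b, b', hA, hB, hAB, hE, rfl, rfl⟩ :=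
    exists_append_of_mem_closedEdges he hf hef.ne
  have halt' : Alternating χ (A ++ B) := by rwa [Alternating, hE]
  rw [alternating_append_iff hA hB] at halt'
  obtain ⟨h1, h2, h3, h4⟩ := halt'
  have hABw := hAB.trans hl
  rw [← hE, closedEdges_append hA hB]
  by_cases hc : χ a' = χ b'
  · have hA' : Alternating χ A := (alternating_iff hA).2 ⟨h1, fun h => h4 (hc.symm.trans h)⟩
    have hB' : Alternating χ B := (alternating_iff hB).2 ⟨h2, fun h => h3 (hc.trans h)⟩
    have hdrop := selfCr_swap hef (walkEdges A + walkEdges B)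
    have hsum : walkEdges A + walkEdges B + {s(a', a), s(b, b')} =
        closedEdges A + closedEdges B := by
      rw [closedEdges_eq hA, closedEdges_eq hB, add_add_add_comm, Sym2.eq_swap (a := b)]
      rfl
    rw [hsum] at hdrop
    by_cases hX : mutualCr (closedEdges A) (closedEdges B) = 0
    · have hdis := (List.nodup_append.1 (hABw.nodup_iff.2 (hw.imp fun h => h.ne))).2.2
      obtain ⟨wA, wB, u, v, α, α', β, β', hs, hsA, hsB⟩ :=
        exists_circSplit hw hABw hA.ne_nil hB.ne_nil
          (not_interleaved (fun x hx hx' => hdis x hx x hx' rfl) hX)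
          (not_interleaved (fun x hx hx' => hdis x hx' x hx rfl) ((mutualCr_comm _ _).trans hX))
      exact Or.inr ⟨A, B, wA, wB, u, v, a, a', b, b', α, α', β, β', hA, hB, rfl, rfl, hE.symm,
        hA', hB', hX, hs, hsA.symm, hsB.symm⟩
    · obtain ⟨l', hl1, hl2, hl3⟩ := exists_merge hA' hB' hX
      exact Or.inl ⟨l', hl1.trans hABw, hl2, by omega⟩
  · refine Or.inl ⟨A ++ B.reverse, ?_, ?_, ?_⟩
    · exact (List.Perm.append_left A (List.reverse_perm B)).trans hABw
    · rw [alternating_append_iff hA hB.reverse, walkEdges_reverse]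
      refine ⟨h1, h2, hc, fun h => ?_⟩
      revert hc h3 h4 h
      cases χ a <;> cases χ a' <;> cases χ b <;> cases χ b' <;> simp
    · rw [closedEdges_append hA hB.reverse, walkEdges_reverse]
      exact selfCr_uncross hef _

theorem colorChanges_circSplit {χ : ℕ → Bool} {w wA wB u v : List ℕ} {α α' β β' : ℕ}
    (h : CircSplit w wA wB u v α α' β β') :
    colorChanges χ wA + colorChanges χ wB + ((if χ α' ≠ χ β then 1 else 0) +
      (if χ β' ≠ χ α then 1 else 0)) = colorChanges χ w + ((if χ α' ≠ χ α then 1 else 0) +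
      (if χ β' ≠ χ β then 1 else 0)) := by
  simp only [colorChanges, h.closedEdges_left, h.closedEdges_right, h.closedEdges,
    closedEdges_append h.ends_left h.ends_right, closedEdges_eq h.ends_left,
    closedEdges_eq h.ends_right, Multiset.countP_add, Multiset.insert_eq_cons,
    Multiset.countP_cons, ← Multiset.cons_zero, Multiset.countP_zero, bi_mk]
  omega

theorem UncrossedSplit.selfCr_le {χ : ℕ → Bool} {w l A B wA wB u v : List ℕ} {e f : Sym2 ℕ}
    {a a' b b' α α' β β' : ℕ} (h : UncrossedSplit χ w l A B wA wB u v e f a a' b b' α α' β β')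
    (hef : ChordCross e f) :
    selfCr (closedEdges A) + selfCr (closedEdges B) + 2 ≤ selfCr (closedEdges l) := by
  obtain ⟨hA, hB, rfl, rfl, hE, -, -, hX, -, -, -⟩ := h
  have h1 := selfCr_add (closedEdges A) (closedEdges B)
  have h2 : closedEdges A + closedEdges B =
      walkEdges A + walkEdges B + {s(a', a), s(b, b')} := by
    rw [closedEdges_eq hA, closedEdges_eq hB, add_add_add_comm, Sym2.eq_swap (a := b)]
    rfl
  have h3 := selfCr_swap hef (walkEdges A + walkEdges B)
  rw [hE, closedEdges_append hA hB]
  rw [h2] at h1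
  omega

theorem UncrossedSplit.length_eq {χ : ℕ → Bool} {w l A B wA wB u v : List ℕ} {e f : Sym2 ℕ}
    {a a' b b' α α' β β' : ℕ} (h : UncrossedSplit χ w l A B wA wB u v e f a a' b b' α α' β β') :
    w.length = wA.length + wB.length := by
  rw [← h.circSplit.perm.length_eq, List.length_append]

/-- Lower bound for the number of crossings of an alternating Hamiltonian closed walk. -/
theorem length_le_selfCr_add_colorChanges {χ : ℕ → Bool} {w l : List ℕ}
    (hw : w.Pairwise (· < ·)) (hl : l.Perm w) (halt : Alternating χ l) :
    w.length ≤ selfCr (closedEdges l) + colorChanges χ w := by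
  induction hN : selfCr (closedEdges l) using Nat.strong_induction_on generalizing w l with
  | _ N ih
  subst hN
  by_cases hex : ∃ e ∈ closedEdges l, ∃ f ∈ closedEdges l, ChordCross e f
  · obtain ⟨e, he, f, hf, hef⟩ := hex
    rcases uncross_cases hw hl halt he hf hef with ⟨l', h1, h2, h3⟩ |
      ⟨A, B, wA, wB, u, v, a, a', b, b', α, α', β, β', h⟩
    · have := ih _ (by omega) hw h1 h2 rfl
      omega
    · have h1 := h.selfCr_le hef
      have h2 := ih _ (by omega) h.circSplit.pairwise_left h.perm_left h.alternating_left rfl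
      have h3 := ih _ (by omega) h.circSplit.pairwise_right h.perm_right h.alternating_right rfl
      have h4 := colorChanges_circSplit (χ := χ) h.circSplit
      have h5 := h.length_eq
      split_ifs at h4 <;> omega
  · have h1 : ∀ g ∈ closedEdges w, Bi χ g := fun g hg => by
      by_contra hg'
      exact hex (exists_chordCross_of_gap_not_mem hw hl hg fun h => hg' (halt g h))
    rw [colorChanges, Multiset.countP_eq_card.2 h1, card_closedEdges]
    omega

/-- An alternating Hamiltonian closed walk attaining the lower bound on the number
of crossings. -/
structure Tight (χ : ℕ → Bool) (w l : List ℕ) : Prop where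
  perm : l.Perm w
  alternating : Alternating χ l
  selfCr_le : selfCr (closedEdges l) + colorChanges χ w ≤ w.length

theorem Ends.eq_pair_of_mem {l : List ℕ} {a b : ℕ} (h : Ends l a b) (hl : l.Nodup)
    (hm : s(b, a) ∈ walkEdges l) : l = [a, b] := by
  obtain ⟨P, Q, x, x', y, y', rfl, hP, hQ, he⟩ := exists_append_of_mem_walkEdges hm
  obtain ⟨h1, h2, h3⟩ := List.nodup_append.1 hl
  have hx := (hP.append hQ).head
  have hy := (hP.append hQ).last
  rw [h.head, Option.some_inj] at hx
  rw [h.last, Option.some_inj] at hy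
  subst hx hy
  rcases Sym2.eq_iff.1 he with ⟨rfl, rfl⟩ | ⟨rfl, rfl⟩
  · exact absurd rfl (h3 _ hP.right_mem _ hQ.right_mem)
  · rw [hP.eq_singleton h1, hQ.eq_singleton h2]
    rfl

theorem Tight.exists_split {χ : ℕ → Bool} {w l : List ℕ} (hw : w.Pairwise (· < ·))
    (h : Tight χ w l) {e f : Sym2 ℕ} (he : e ∈ closedEdges l) (hf : f ∈ closedEdges l)
    (hef : ChordCross e f) : ∃ A B wA wB u v a a' b b' α α' β β',
      UncrossedSplit χ w l A B wA wB u v e f a a' b b' α α' β β' ∧ Tight χ wA A ∧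
      Tight χ wB B ∧
      selfCr (closedEdges l) = selfCr (closedEdges A) + selfCr (closedEdges B) + 2 ∧
      χ α' = χ β ∧ χ β' = χ α ∧ χ α' ≠ χ α := by
  have h0 := h.selfCr_le
  rcases uncross_cases hw h.perm h.alternating he hf hef with ⟨l', h1, h2, h3⟩ |
    ⟨A, B, wA, wB, u, v, a, a', b, b', α, α', β, β', hs⟩
  · have := length_le_selfCr_add_colorChanges hw h1 h2
    omega
  · have h1 := hs.selfCr_le hef
    have h2 := length_le_selfCr_add_colorChanges hs.circSplit.pairwise_left hs.perm_left
      hs.alternating_left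
    have h3 := length_le_selfCr_add_colorChanges hs.circSplit.pairwise_right hs.perm_right
      hs.alternating_right
    have h4 := colorChanges_circSplit (χ := χ) hs.circSplit
    have h5 := hs.length_eq
    have h6 : (if χ α' ≠ χ α then 1 else 0) ≤ 1 := by split_ifs <;> omega
    have h7 : (if χ β' ≠ χ β then 1 else 0) ≤ 1 := by split_ifs <;> omega
    refine ⟨A, B, wA, wB, u, v, a, a', b, b', α, α', β, β', hs,
      ⟨hs.perm_left, hs.alternating_left, by omega⟩,
      ⟨hs.perm_right, hs.alternating_right, by omega⟩, by omega, ?_, ?_, ?_⟩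
    · by_contra hc
      rw [if_pos hc] at h4
      omega
    · by_contra hc
      rw [if_pos hc] at h4
      omega
    · intro hc
      rw [if_neg (not_not.2 hc)] at h4
      omega

section UncrossedSplit

variable {χ : ℕ → Bool} {w l A B wA wB u v : List ℕ} {e f : Sym2 ℕ}
  {a a' b b' α α' β β' : ℕ}

theorem UncrossedSplit.closedEdges_perm
    (h : UncrossedSplit χ w l A B wA wB u v e f a a' b b' α α' β β') :
    closedEdges l = walkEdges A + walkEdges B + {e, f} := by
  rw [h.edges_eq, closedEdges_append h.ends_left h.ends_right, h.edge_left, h.edge_right]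

theorem UncrossedSplit.cr_add_cr_le
    (h : UncrossedSplit χ w l A B wA wB u v e f a a' b b' α α' β β') (hef : ChordCross e f)
    (hs : selfCr (closedEdges l) = selfCr (closedEdges A) + selfCr (closedEdges B) + 2)
    {g : Sym2 ℕ} (hg : g ∈ walkEdges A + walkEdges B) :
    cr g e + cr g f ≤ cr g s(a', a) + cr g s(b', b) := by
  have h1 := selfCr_add (closedEdges A) (closedEdges B)
  have h2 : closedEdges A + closedEdges B =
      walkEdges A + walkEdges B + {s(a', a), s(b, b')} := by
    rw [closedEdges_eq h.ends_left, closedEdges_eq h.ends_right, add_add_add_comm,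
      Sym2.eq_swap (a := b)]
    rfl
  have h3 := h.closedEdges_perm
  have h4 := h.mutualCr_eq
  obtain rfl := h.edge_left
  obtain rfl := h.edge_right
  rw [h2] at h1
  rw [h3] at hs
  rw [Sym2.eq_swap (a := b') (b := b), Sym2.eq_swap (a := b') (b := a)]
  rw [Sym2.eq_swap (a := b') (b := a)] at hef hs
  exact cr_le_of_selfCr_uncross hef (by omega) hg

theorem UncrossedSplit.closing_mem
    (h : UncrossedSplit χ w l A B wA wB u v e f a a' b b' α α' β β') :
    s(a', a) ∈ closedEdges A := by
  simp [closedEdges_eq h.ends_left]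

theorem UncrossedSplit.gap_mem
    (h : UncrossedSplit χ w l A B wA wB u v e f a a' b b' α α' β β') :
    s(α', α) ∈ closedEdges wA := by
  simp [h.circSplit.closedEdges_left, closedEdges_eq h.circSplit.ends_left]

theorem UncrossedSplit.closing_eq
    (h : UncrossedSplit χ w l A B wA wB u v e f a a' b b' α α' β β') (hef : ChordCross e f)
    (hs : selfCr (closedEdges l) = selfCr (closedEdges A) + selfCr (closedEdges B) + 2)
    (hm : s(α', α) ∈ closedEdges A) : s(a', a) = s(α', α) := by
  by_contra hne
  have hmem := hm
  rw [closedEdges_eq h.ends_left, Multiset.mem_add, Multiset.mem_singleton] at hm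
  have hm := hm.resolve_right fun h => hne h.symm
  have ha := h.perm_left.mem_iff.1 h.ends_left.left_mem
  have ha' := h.perm_left.mem_iff.1 h.ends_left.right_mem
  have h1 := h.cr_add_cr_le hef hs (Multiset.mem_add.2 (Or.inl hm))
  rw [cr_eq_zero.2 (not_chordCross_of_mem_closedEdges h.circSplit.pairwise_left h.gap_mem ha' ha),
    cr_eq_zero.2 (mutualCr_eq_zero.1 h.mutualCr_eq _ hmem _ h.symm.closing_mem)] at h1
  have h2 : ¬ ChordCross s(α', α) s(a', b) := by
    rw [← h.edge_left, ← cr_eq_zero]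
    omega
  have h3 : ¬ ChordCross s(α', α) s(a, b') := by
    rw [Sym2.eq_swap (a := a), ← h.edge_right, ← cr_eq_zero]
    omega
  have h4 := h.alternating_left.ends_ne h.ends_left
  have h5 : a' = α ∨ a' = α' := by
    by_contra hc
    push Not at hc
    exact h2 (h.circSplit.gap_left a' ha' hc.1 hc.2 b
      (h.perm_right.mem_iff.1 h.ends_right.left_mem))
  have h6 : a = α ∨ a = α' := by
    by_contra hc
    push Not at hc
    exact h3 (h.circSplit.gap_left a ha hc.1 hc.2 b'
      (h.perm_right.mem_iff.1 h.ends_right.right_mem))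
  rcases h5 with rfl | rfl <;> rcases h6 with rfl | rfl
  · exact h4 rfl
  · exact hne Sym2.eq_swap
  · exact hne rfl
  · exact h4 rfl

theorem UncrossedSplit.mem_of_mem_walkEdges
    (h : UncrossedSplit χ w l A B wA wB u v e f a a' b b' α α' β β')
    (hc : s(a', a) = s(α', α))
    {g : Sym2 ℕ} (hg : g ∈ walkEdges u) (hgA : g ∈ closedEdges A) : g ∈ closedEdges l := by
  rw [h.closedEdges_perm, Multiset.mem_add, Multiset.mem_add]
  refine Or.inl (Or.inl ?_)
  rw [closedEdges_eq h.ends_left, Multiset.mem_add, Multiset.mem_singleton] at hgA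
  rcases hgA with hgA | rfl
  · exact hgA
  rw [hc] at hg
  have hA : wA.Nodup := h.circSplit.pairwise_left.imp fun h => h.ne
  have h1 := h.circSplit.ends_left.eq_pair_of_mem (h.circSplit.perm_left.nodup_iff.2 hA) hg
  have h2 : A.length = 2 := by
    rw [h.perm_left.length_eq, ← h.circSplit.perm_left.length_eq, h1]
    rfl
  obtain ⟨x, y, rfl⟩ := List.length_eq_two.1 h2
  have hx := h.ends_left.head
  have hy := h.ends_left.last
  simp only [List.head?_cons, Option.some_inj] at hx
  simp only [List.getLast?_cons_cons, List.getLast?_singleton, Option.some_inj] at hy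
  subst hx hy
  simp [walkEdges, Sym2.eq_swap]

end UncrossedSplit

/-- A crossing-minimal alternating Hamiltonian closed walk contains every bridge. -/
theorem Tight.mem_of_bi {χ : ℕ → Bool} {w l : List ℕ} (hw : w.Pairwise (· < ·))
    (h : Tight χ w l) {g : Sym2 ℕ} (hg : g ∈ closedEdges w) (hb : Bi χ g) :
    g ∈ closedEdges l := by
  induction hN : selfCr (closedEdges l) using Nat.strong_induction_on generalizing w l g with
  | _ N ih
  subst hN
  by_contra hgl
  obtain ⟨e, he, f, hf, hef⟩ := exists_chordCross_of_gap_not_mem hw h.perm hg hgl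
  obtain ⟨A, B, wA, wB, u, v, a, a', b, b', α, α', β, β', hs, hA, hB, hsum, h1, h2, h3⟩ :=
    h.exists_split hw he hf hef
  have key : ∀ {A B wA wB u v : List ℕ} {e f : Sym2 ℕ} {a a' b b' α α' β β' : ℕ}, ChordCross e f →
      UncrossedSplit χ w l A B wA wB u v e f a a' b b' α α' β β' → Tight χ wA A →
      selfCr (closedEdges l) = selfCr (closedEdges A) + selfCr (closedEdges B) + 2 →
      χ α' ≠ χ α → g ∉ walkEdges u := by
    intro A B wA wB u v e f a a' b b' α α' β β' hef hs hA hsum h3 hgu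
    have hgu' : g ∈ closedEdges wA := by
      rw [hs.circSplit.closedEdges_left, closedEdges_eq hs.circSplit.ends_left]
      exact Multiset.mem_add.2 (Or.inl hgu)
    have hm := ih _ (by omega) hs.circSplit.pairwise_left hA hs.gap_mem (bi_mk.2 h3) rfl
    exact hgl (hs.mem_of_mem_walkEdges (hs.closing_eq hef hsum hm) hgu
      (ih _ (by omega) hs.circSplit.pairwise_left hA hgu' hb rfl))
  have hu := key hef hs hA hsum h3
  have hv := key hef.symm hs.symm hB (by omega) fun hc => h3 (by rw [h1, ← hc, h2])
  rw [hs.circSplit.closedEdges, closedEdges_append hs.circSplit.ends_left hs.circSplit.ends_right]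
    at hg
  simp only [Multiset.mem_add, hu, hv, or_self, false_or, Multiset.insert_eq_cons,
    Multiset.mem_cons, Multiset.mem_singleton] at hg
  rcases hg with rfl | rfl
  · exact bi_mk.1 hb h1
  · exact bi_mk.1 hb h2

/-- Each edge of a crossing-minimal alternating Hamiltonian closed walk is crossed by
at most one other edge. -/
theorem Tight.sum_cr_le_one {χ : ℕ → Bool} {w l : List ℕ} (hw : w.Pairwise (· < ·))
    (h : Tight χ w l) {e : Sym2 ℕ} (he : e ∈ closedEdges l) :
    ((closedEdges l).map (cr e)).sum ≤ 1 := by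
  by_cases hex : ∃ f ∈ closedEdges l, ChordCross e f
  · obtain ⟨f, hf, hef⟩ := hex
    obtain ⟨A, B, wA, wB, u, v, a, a', b, b', α, α', β, β', hs, hA, hB, hsum, h1, h2, h3⟩ :=
      h.exists_split hw he hf hef
    have hα := hA.mem_of_bi hs.circSplit.pairwise_left hs.gap_mem (bi_mk.2 h3)
    have hβ := hB.mem_of_bi hs.circSplit.pairwise_right hs.symm.gap_mem
      (bi_mk.2 fun hc => h3 (by rw [h1, ← hc, h2]))
    have hα' := hs.closing_eq hef hsum hα
    have hβ' := hs.symm.closing_eq hef.symm (by omega) hβ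
    have key : ∀ g ∈ walkEdges A + walkEdges B, cr e g = 0 := by
      intro g hg
      have h4 := hs.cr_add_cr_le hef hsum hg
      have h5 : cr g s(a', a) = 0 ∧ cr g s(b', b) = 0 := by
        simp only [cr_eq_zero]
        rw [Multiset.mem_add] at hg
        rcases hg with hg | hg
        · have hgA : g ∈ closedEdges A := by
            rw [closedEdges_eq hs.ends_left]
            exact Multiset.mem_add.2 (Or.inl hg)
          refine ⟨?_, mutualCr_eq_zero.1 hs.mutualCr_eq _ hgA _ hs.symm.closing_mem⟩
          induction g with | _ x y
          obtain ⟨hx, hy⟩ := mem_of_mem_walkEdges hg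
          rw [hα', chordCross_comm]
          exact not_chordCross_of_mem_closedEdges hs.circSplit.pairwise_left hs.gap_mem
            (hs.perm_left.mem_iff.1 hx) (hs.perm_left.mem_iff.1 hy)
        · have hgB : g ∈ closedEdges B := by
            rw [closedEdges_eq hs.ends_right]
            exact Multiset.mem_add.2 (Or.inl hg)
          refine ⟨mutualCr_eq_zero.1 hs.symm.mutualCr_eq _ hgB _ hs.closing_mem, ?_⟩
          induction g with | _ x y
          obtain ⟨hx, hy⟩ := mem_of_mem_walkEdges hg
          rw [hβ', chordCross_comm]
          exact not_chordCross_of_mem_closedEdges hs.circSplit.pairwise_right hs.symm.gap_mem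
            (hs.perm_right.mem_iff.1 hx) (hs.perm_right.mem_iff.1 hy)
      rw [cr_comm]
      omega
    rw [hs.closedEdges_perm, Multiset.map_add, Multiset.sum_add, Multiset.map_congr rfl key]
    simp [cr_self, cr_eq_one.2 hef]
  · push Not at hex
    rw [Multiset.map_congr rfl fun f hf => cr_eq_zero.2 (hex f hf)]
    simp

/-- Both colors occur equally often in `l`. -/
def ColorBalanced (χ : ℕ → Bool) (l : List ℕ) : Prop :=
  ∀ c, l.countP (χ · == c) = l.countP (χ · == !c)

theorem colorBalanced_iff {χ : ℕ → Bool} {l : List ℕ} (c : Bool) :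
    ColorBalanced χ l ↔ l.countP (χ · == c) = l.countP (χ · == !c) := by
  refine ⟨fun h => h c, fun h c' => ?_⟩
  by_cases hc : c' = c
  · rw [hc, h]
  · obtain rfl : c' = !c := Bool.eq_not.2 hc
    rw [Bool.not_not, h]

theorem exists_first_deficit {χ : ℕ → Bool} {c : Bool} (z : List ℕ) (k : ℕ)
    (h : k + z.countP (χ · == c) < z.countP (χ · == !c)) :
    ∃ P y Q, z = P ++ y :: Q ∧ χ y = !c ∧ k + P.countP (χ · == c) = P.countP (χ · == !c) ∧
      (P = [] ∨ ∃ P' x, P = P' ++ [x] ∧ χ x = !c) := by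
  induction z generalizing k with
  | nil => simp at h
  | cons x t ih =>
    by_cases hx : χ x = c
    · have hx' : (χ x == !c) = false := by simp [hx]
      simp only [List.countP_cons, hx, beq_self_eq_true, if_true] at h
      simp only [Bool.beq_not_self, Bool.false_eq_true, if_false] at h
      obtain ⟨P, y, Q, rfl, hy, hP, hP'⟩ := ih (k + 1) (by omega)
      refine ⟨x :: P, y, Q, rfl, hy, ?_, Or.inr ?_⟩
      · simp [hx]
        omega
      · rcases hP' with rfl | ⟨P', x', rfl, hx'⟩
        · simp at hP
        · exact ⟨x :: P', x', rfl, hx'⟩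
    · have hx : χ x = !c := Bool.eq_not.2 hx
      cases k with
      | zero => exact ⟨[], x, t, rfl, hx, rfl, Or.inl rfl⟩
      | succ k =>
        simp [hx] at h
        obtain ⟨P, y, Q, rfl, hy, hP, hP'⟩ := ih k (by omega)
        refine ⟨x :: P, y, Q, rfl, hy, ?_, Or.inr ?_⟩
        · simp [hx]
          omega
        · rcases hP' with rfl | ⟨P', x', rfl, hx'⟩
          · exact ⟨[], x, rfl, hx⟩
          · exact ⟨x :: P', x', rfl, hx'⟩

theorem ColorBalanced.exists_append {χ : ℕ → Bool} {z : List ℕ} {p q : ℕ} (h : ColorBalanced χ z)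
    (hz : Ends z p q) (hpq : χ q = χ p) : ∃ X Y p' q', z = X ++ Y ∧ Ends X p p' ∧ Ends Y q' q ∧
      ColorBalanced χ X ∧ ColorBalanced χ Y ∧ χ p' = χ q' ∧ χ p ≠ χ p' := by
  obtain ⟨t, ht⟩ : ∃ t, z = t ++ [q] := by
    obtain ⟨t, ht⟩ := hz.reverse.exists_cons
    exact ⟨t.reverse, by rw [← List.reverse_reverse z, ht, List.reverse_cons]⟩
  subst ht
  have h0 := h (χ p)
  have h1 : 0 + t.countP (χ · == χ p) < t.countP (χ · == !χ p) := by
    simp [List.countP_append, hpq] at h0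
    omega
  obtain ⟨P, y, Q, rfl, hy, hP, hP'⟩ := exists_first_deficit t 0 h1
  rcases hP' with rfl | ⟨P', x, rfl, hx⟩
  · have := hz.head
    simp at this
    subst this
    simp at hy
  refine ⟨P' ++ [x], y :: Q ++ [q], x, y, by simp, ⟨?_, by simp⟩, ⟨rfl, List.getLast?_concat⟩, ?_, ?_, ?_, ?_⟩
  · have := hz.head
    cases P' <;> simpa using this
  · rw [colorBalanced_iff (χ p)]
    omega
  · rw [colorBalanced_iff (χ p)]
    simp only [List.countP_append] at h0 hP ⊢
    omega
  · rw [hx, hy]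
  · rw [hx]
    simp

theorem exists_rotation_of_mono {χ : ℕ → Bool} {w : List ℕ} {g : Sym2 ℕ} (hg : g ∈ closedEdges w)
    (hb : ¬ Bi χ g) : ∃ w₁ w₂ p q, w = w₁ ++ w₂ ∧ Ends (w₂ ++ w₁) p q ∧ χ q = χ p := by
  by_cases hw : w = []
  · subst hw
    simp [closedEdges, walkEdges] at hg
  obtain ⟨a, b, hab⟩ := exists_ends hw
  rw [closedEdges_eq hab, Multiset.mem_add, Multiset.mem_singleton] at hg
  rcases hg with hg | rfl
  · obtain ⟨P, Q, x, x', y, y', rfl, hP, hQ, rfl⟩ := exists_append_of_mem_walkEdges hg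
    rw [bi_mk, not_not] at hb
    exact ⟨P, Q, y, x', rfl, hQ.append hP, hb⟩
  · rw [bi_mk, not_not] at hb
    exact ⟨[], w, a, b, rfl, by simpa using hab, hb⟩

theorem exists_circSplit_of_rotation {w₁ w₂ X Y : List ℕ} {α α' β β' : ℕ}
    (hw : (w₁ ++ w₂).Pairwise (· < ·)) (h : w₂ ++ w₁ = X ++ Y) (hX : Ends X α α')
    (hY : Ends Y β β') : ∃ wA wB, CircSplit (w₁ ++ w₂) wA wB X Y α α' β β' := by
  rcases List.append_eq_append_iff.1 h with ⟨t, rfl, rfl⟩ | ⟨t, rfl, rfl⟩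
  · exact ⟨_, _, circSplit_of_append hw hY hX⟩
  · rw [← List.append_assoc] at hw ⊢
    exact ⟨_, _, (circSplit_of_append hw hX hY).symm⟩

theorem ColorBalanced.perm {χ : ℕ → Bool} {l l' : List ℕ} (h : ColorBalanced χ l) (hl : l.Perm l') :
    ColorBalanced χ l' := fun c => by
  rw [← hl.countP_eq, ← hl.countP_eq, h c]

/-- Tight walks on the two arcs of a splitting are merged into a tight walk. -/
theorem exists_tight_of_circSplit {χ : ℕ → Bool} {w wA wB u v A B : List ℕ} {α α' β β' : ℕ}
    (h : CircSplit w wA wB u v α α' β β') (hA : Tight χ wA A) (hB : Tight χ wB B)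
    (h1 : χ α' = χ β) (h2 : χ β' = χ α) (h3 : χ α' ≠ χ α) : ∃ l, Tight χ w l := by
  have h4 : χ β' ≠ χ β := fun hc => h3 (by rw [h1, ← hc, h2])
  have hα : s(α, α') ∈ closedEdges A := by
    rw [Sym2.eq_swap]
    refine hA.mem_of_bi h.pairwise_left ?_ (bi_mk.2 h3)
    simp [h.closedEdges_left, closedEdges_eq h.ends_left]
  have hβ : s(β', β) ∈ closedEdges B := by
    refine hB.mem_of_bi h.pairwise_right ?_ (bi_mk.2 h4)
    simp [h.closedEdges_right, closedEdges_eq h.ends_right]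
  obtain ⟨A', hA1, hA2, hA3⟩ := exists_ends_of_mem_closedEdges hα
  obtain ⟨B', hB1, hB2, hB3⟩ := exists_ends_of_mem_closedEdges hβ
  have hAw := hA2.trans hA.perm
  have hBw := hB2.trans hB.perm
  have hA' : Alternating χ A' := by
    rw [Alternating, hA3]
    exact hA.alternating
  have hB' : Alternating χ B' := by
    rw [Alternating, hB3]
    exact hB.alternating
  refine ⟨A' ++ B', (hAw.append hBw).trans h.perm, ?_, ?_⟩
  · rw [alternating_append_iff hA1 hB1]
    rw [alternating_iff hA1] at hA'
    rw [alternating_iff hB1] at hB'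
    refine ⟨hA'.1, hB'.1, ?_, ?_⟩
    · rwa [h2]
    · rwa [← h1]
  · have e1 : ∀ g ∈ walkEdges A' + walkEdges B', cr g s(α', β') + cr g s(β, α) = 0 := by
      intro g hg
      rw [Nat.add_eq_zero_iff, cr_eq_zero, cr_eq_zero]
      induction g with | _ x y
      rcases Multiset.mem_add.1 hg with hg | hg <;> obtain ⟨hx, hy⟩ := mem_of_mem_walkEdges hg
      · exact h.not_cross_left x (hAw.mem_iff.1 hx) y (hAw.mem_iff.1 hy)
      · exact h.not_cross_right x (hBw.mem_iff.1 hx) y (hBw.mem_iff.1 hy)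
    have e2 : mutualCr (closedEdges A) (closedEdges B) = 0 := by
      rw [mutualCr_eq_zero]
      intro e he f hf
      induction e with | _ x y
      induction f with | _ z t
      obtain ⟨hx, hy⟩ := mem_of_mem_closedEdges he
      obtain ⟨hz, ht⟩ := mem_of_mem_closedEdges hf
      exact h.not_cross x (hA.perm.mem_iff.1 hx) y (hA.perm.mem_iff.1 hy)
        z (hB.perm.mem_iff.1 hz) t (hB.perm.mem_iff.1 ht)
    have e3 := selfCr_add (closedEdges A) (closedEdges B)
    have e4 : closedEdges A + closedEdges B =
        walkEdges A' + walkEdges B' + {s(α', α), s(β, β')} := by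
      rw [← hA3, ← hB3, closedEdges_eq hA1, closedEdges_eq hB1, add_add_add_comm]
      rfl
    have e5 : cr s(α', β') s(β, α) ≤ 1 := by
      unfold cr
      split_ifs <;> omega
    have e6 := colorChanges_circSplit (χ := χ) h
    have e7 := hA.selfCr_le
    have e8 := hB.selfCr_le
    have e9 := h.perm.length_eq
    rw [List.length_append] at e9
    rw [closedEdges_append hA1 hB1, selfCr_add_pair, Multiset.map_congr rfl e1]
    rw [e4, selfCr_add_pair, e2] at e3
    rw [if_neg (not_not.2 h1), if_neg (not_not.2 h2), if_pos h3, if_pos h4] at e6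
    simp only [Multiset.map_const', Multiset.sum_replicate, smul_zero, mul_zero, add_zero]
    omega

theorem exists_tight {χ : ℕ → Bool} {w : List ℕ} (hw : w.Pairwise (· < ·)) (h : ColorBalanced χ w) :
    ∃ l, Tight χ w l := by
  induction hN : w.length using Nat.strong_induction_on generalizing w with
  | _ N ih
  subst hN
  by_cases hex : ∀ g ∈ closedEdges w, Bi χ g
  · refine ⟨w, List.Perm.refl _, hex, ?_⟩
    have h0 : selfCr (closedEdges w) = 0 := by
      refine mutualCr_eq_zero.2 fun e he f hf => ?_
      induction f with | _ x y
      exact not_chordCross_of_mem_closedEdges hw he (mem_of_mem_closedEdges hf).1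
        (mem_of_mem_closedEdges hf).2
    rw [h0, zero_add, ← card_closedEdges]
    exact Multiset.countP_le_card _ _
  · push Not at hex
    obtain ⟨g, hg, hb⟩ := hex
    obtain ⟨w₁, w₂, p, q, rfl, hpq, hc⟩ := exists_rotation_of_mono hg hb
    obtain ⟨X, Y, p', q', hXY, hX, hY, hbX, hbY, h1, h2⟩ :=
      (h.perm List.perm_append_comm).exists_append hpq hc
    obtain ⟨wA, wB, hs⟩ := exists_circSplit_of_rotation hw hXY hX hY
    have hl := hs.perm.length_eq
    rw [List.length_append] at hl
    have hlA := List.length_pos_iff.2 hX.ne_nil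
    have hlB := List.length_pos_iff.2 hY.ne_nil
    rw [hs.perm_left.length_eq] at hlA
    rw [hs.perm_right.length_eq] at hlB
    obtain ⟨A, hA⟩ := ih wA.length (by omega) hs.pairwise_left (hbX.perm hs.perm_left) rfl
    obtain ⟨B, hB⟩ := ih wB.length (by omega) hs.pairwise_right (hbY.perm hs.perm_right) rfl
    exact exists_tight_of_circSplit hs hA hB h1 hc h2.symm

theorem segCross_comm {e f : Pt × Pt} : SegCross e f ↔ SegCross f e := by
  simp only [SegCross, and_comm]

theorem segCross_swap_left {a b : Pt} {f : Pt × Pt} : SegCross (a, b) f ↔ SegCross (b, a) f := by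
  simp only [SegCross, openSegment_symm ℝ a b]

theorem segCross_swap_right {c d : Pt} {e : Pt × Pt} : SegCross e (c, d) ↔ SegCross e (d, c) := by
  simp only [SegCross, openSegment_symm ℝ c d]

theorem det2_rotate (a b c : Pt) : det2 a b c = det2 b c a := by
  unfold det2
  ring

theorem det2_self_left (a b : Pt) : det2 a b a = 0 := by
  unfold det2
  ring

theorem det2_self_right (a b : Pt) : det2 a b b = 0 := by
  unfold det2
  ring

/-- The endpoints of a segment crossing the segment `ab` lie weakly on different sides
of the line `ab`. -/
theorem SegCross.exists_combo {a b c d : Pt} (h : SegCross (a, b) (c, d)) :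
    ∃ s t : ℝ, 0 < s ∧ 0 < t ∧ s * det2 a b c + t * det2 a b d = 0 := by
  obtain ⟨x, ⟨p, q, hp, hq, hpq, rfl⟩, s, t, hs, ht, hst, hx⟩ := h
  refine ⟨s, t, hs, ht, ?_⟩
  have h1 : s * c.1 + t * d.1 = p * a.1 + q * b.1 := congrArg Prod.fst hx
  have h2 : s * c.2 + t * d.2 = p * a.2 + q * b.2 := congrArg Prod.snd hx
  obtain rfl : p = 1 - q := by linarith
  obtain rfl : s = 1 - t := by linarith
  unfold det2
  linear_combination (b.1 - a.1) * h2 - (b.2 - a.2) * h1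

theorem segCross_of_det2 {a b c d : Pt} (h1 : det2 c d a < 0) (h2 : 0 < det2 c d b)
    (h3 : 0 < det2 a b c) (h4 : det2 a b d < 0) : SegCross (a, b) (c, d) := by
  have key : det2 c d b - det2 c d a = det2 a b c - det2 a b d := by
    unfold det2
    ring
  have hpos : 0 < det2 c d b - det2 c d a := by linarith
  refine ⟨(det2 c d b / (det2 c d b - det2 c d a)) • a +
    (-det2 c d a / (det2 c d b - det2 c d a)) • b, ⟨_, _, by positivity,
      div_pos (by linarith) hpos, by field_simp; ring, rfl⟩, ?_⟩
  refine ⟨-det2 a b d / (det2 c d b - det2 c d a), det2 a b c / (det2 c d b - det2 c d a),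
    div_pos (by linarith) hpos, by positivity, by rw [key] at hpos ⊢; field_simp; ring, ?_⟩
  ext
  · simp only [Prod.fst_add, Prod.smul_fst, smul_eq_mul]
    field_simp
    unfold det2
    ring
  · simp only [Prod.snd_add, Prod.smul_snd, smul_eq_mul]
    field_simp
    unfold det2
    ring

/-- The points `q 0, …, q (m - 1)` are in convex position, in clockwise order. -/
def Clockwise (m : ℕ) (q : ℕ → Pt) : Prop :=
  ∀ i j k, i < j → j < k → k < m → det2 (q i) (q j) (q k) < 0

theorem Clockwise.det2_sign {m : ℕ} {q : ℕ → Pt} (hq : Clockwise m q) {a b x : ℕ} (hab : a < b)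
    (hb : b < m) (hx : x < m) : (a < x ∧ x < b → 0 < det2 (q a) (q b) (q x)) ∧
      (x < a ∨ b < x → det2 (q a) (q b) (q x) < 0) := by
  refine ⟨fun h => ?_, fun h => ?_⟩
  · have h1 := hq a x b h.1 h.2 hb
    have h2 : det2 (q a) (q b) (q x) = - det2 (q a) (q x) (q b) := by
      unfold det2
      ring
    linarith
  · rcases h with h | h
    · rw [← det2_rotate]
      exact hq x a b h hab hb
    · exact hq a b x hab h hx

theorem Clockwise.segCross_iff_of_lt {m : ℕ} {q : ℕ → Pt} (hq : Clockwise m q) {a b c d : ℕ}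
    (hab : a < b) (hcd : c < d) (hb : b < m) (hd : d < m) (hne : s(a, b) ≠ s(c, d)) :
    SegCross (q a, q b) (q c, q d) ↔ ChordCross s(a, b) s(c, d) := by
  rw [chordCross_of_lt hab hcd]
  have ea := hq.det2_sign hcd hd (hab.trans hb)
  have eb := hq.det2_sign hcd hd hb
  have ec := hq.det2_sign hab hb (hcd.trans hd)
  have ed := hq.det2_sign hab hb hd
  constructor
  · intro h
    obtain ⟨s, t, hs, ht, hst⟩ := h.exists_combo
    have split : ∀ x, (x = a ∨ x = b) ∨ (a < x ∧ x < b) ∨ (x < a ∨ b < x) := by omega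
    have zero : ∀ x, (x = a ∨ x = b) → det2 (q a) (q b) (q x) = 0 := by
      rintro x (rfl | rfl)
      · exact det2_self_left _ _
      · exact det2_self_right _ _
    rcases split c with hc | hc | hc <;> rcases split d with hd' | hd' | hd'
    · exact absurd (by rw [Sym2.eq_iff]; omega) hne
    · have := mul_pos ht (ed.1 hd')
      rw [zero c hc] at hst
      linarith
    · have := mul_neg_of_pos_of_neg ht (ed.2 hd')
      rw [zero c hc] at hst
      linarith
    · have := mul_pos hs (ec.1 hc)
      rw [zero d hd'] at hst
      linarith
    · have := mul_pos hs (ec.1 hc)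
      have := mul_pos ht (ed.1 hd')
      linarith
    · omega
    · have := mul_neg_of_pos_of_neg hs (ec.2 hc)
      rw [zero d hd'] at hst
      linarith
    · omega
    · have := mul_neg_of_pos_of_neg hs (ec.2 hc)
      have := mul_neg_of_pos_of_neg ht (ed.2 hd')
      linarith
  · rintro (h | h)
    · exact segCross_of_det2 (ea.2 (by omega)) (eb.1 (by omega)) (ec.1 (by omega)) (ed.2 (by omega))
    · exact segCross_comm.1 (segCross_of_det2 (ec.2 (by omega)) (ed.1 (by omega)) (ea.1 (by omega))
        (eb.2 (by omega)))

theorem Clockwise.segCross_iff {m : ℕ} {q : ℕ → Pt} (hq : Clockwise m q) {a b c d : ℕ}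
    (ha : a < m) (hb : b < m) (hc : c < m) (hd : d < m) (hab : a ≠ b) (hcd : c ≠ d)
    (hne : s(a, b) ≠ s(c, d)) :
    SegCross (q a, q b) (q c, q d) ↔ ChordCross s(a, b) s(c, d) := by
  wlog h : a < b generalizing a b
  · rw [Sym2.eq_swap (a := a)] at hne ⊢
    rw [segCross_swap_left]
    exact this hb ha hab.symm hne (by omega)
  wlog h' : c < d generalizing c d
  · rw [Sym2.eq_swap (a := c)] at hne ⊢
    rw [segCross_swap_right]
    exact this hd hc hcd.symm hne (by omega)
  exact hq.segCross_iff_of_lt h h' hb hd hne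

theorem sum_map_eq_sum_range {α : Type*} (l : List α) (d : α) (f : α → ℕ) :
    (l.map f).sum = ∑ i ∈ Finset.range l.length, f (l.getD i d) := by
  induction l with
  | nil => rfl
  | cons x t ih =>
    rw [List.map_cons, List.sum_cons, List.length_cons, Finset.sum_range_succ', ih, add_comm]
    rfl

theorem edgeCrossCount_eq_sum (es : List (Pt × Pt)) (i : ℕ) :
    edgeCrossCount es i = ∑ j ∈ Finset.range es.length, if j ≠ i ∧
      SegCross (es.getD i ((0, 0), (0, 0))) (es.getD j ((0, 0), (0, 0))) then 1 else 0 := by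
  rw [edgeCrossCount, Finset.card_filter]

theorem two_mul_crossNum (es : List (Pt × Pt)) :
    2 * crossNum es = ∑ i ∈ Finset.range es.length, edgeCrossCount es i := by
  have h1 : crossNum es = ∑ i ∈ Finset.range es.length, ∑ j ∈ Finset.range es.length,
      if i < j ∧ SegCross (es.getD i ((0, 0), (0, 0))) (es.getD j ((0, 0), (0, 0)))
        then 1 else 0 := by
    rw [crossNum, Finset.card_filter, Finset.sum_product]
  have h2 : crossNum es = ∑ i ∈ Finset.range es.length, ∑ j ∈ Finset.range es.length,
      if j < i ∧ SegCross (es.getD i ((0, 0), (0, 0))) (es.getD j ((0, 0), (0, 0)))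
        then 1 else 0 := by
    rw [h1, Finset.sum_comm]
    simp only [segCross_comm]
  rw [two_mul]
  nth_rw 1 [h1]
  rw [h2, ← Finset.sum_add_distrib]
  refine Finset.sum_congr rfl fun i _ => ?_
  rw [edgeCrossCount_eq_sum, ← Finset.sum_add_distrib]
  refine Finset.sum_congr rfl fun j _ => ?_
  rcases lt_trichotomy i j with h | rfl | h
  · simp [h, h.ne', h.not_gt]
  · simp
  · simp [h, h.ne, h.not_gt]

theorem walkEdges_eq_map_zip (L : List ℕ) :
    walkEdges L = ((L.zip L.tail).map fun p => s(p.1, p.2) : List (Sym2 ℕ)) := by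
  induction L with
  | nil => rfl
  | cons x t ih =>
    cases t with
    | nil => rfl
    | cons y t =>
      rw [walkEdges, ih]
      rfl

theorem pathEdges_map (q : ℕ → Pt) (L : List ℕ) :
    pathEdges (L.map q) = (L.zip L.tail).map fun p => (q p.1, q p.2) := by
  rw [pathEdges, ← List.map_tail, List.zip_map]
  rfl

theorem zip_tail_injective {L : List ℕ} (hL : L.Nodup) {i j : ℕ} (hi : i < (L.zip L.tail).length)
    (hj : j < (L.zip L.tail).length)
    (h : s((L.zip L.tail)[i].1, (L.zip L.tail)[i].2) =
      s((L.zip L.tail)[j].1, (L.zip L.tail)[j].2)) : i = j := by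
  simp only [List.getElem_zip, List.getElem_tail, Sym2.eq_iff, hL.getElem_inj_iff] at h
  omega

/-- Crossings of an edge in a polygonal path on points in convex position. -/
theorem Clockwise.edgeCrossCount_eq {m : ℕ} {q : ℕ → Pt} (hq : Clockwise m q) {L : List ℕ}
    (hL : L.Nodup) (hm : ∀ x ∈ L, x < m) {i : ℕ} (hi : i < (L.zip L.tail).length) :
    edgeCrossCount (pathEdges (L.map q)) i =
      ((walkEdges L).map (cr s((L.zip L.tail)[i].1, (L.zip L.tail)[i].2))).sum := by
  rw [edgeCrossCount_eq_sum, pathEdges_map, walkEdges_eq_map_zip, Multiset.map_coe,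
    Multiset.sum_coe, List.map_map, sum_map_eq_sum_range _ (0, 0), List.length_map]
  refine Finset.sum_congr rfl fun j hj => ?_
  rw [Finset.mem_range] at hj
  have mem : ∀ {k} (hk : k < (L.zip L.tail).length), (L.zip L.tail)[k].1 < m ∧
      (L.zip L.tail)[k].2 < m ∧ (L.zip L.tail)[k].1 ≠ (L.zip L.tail)[k].2 := by
    intro k hk
    refine ⟨hm _ (List.of_mem_zip (List.getElem_mem hk)).1,
      hm _ (List.mem_of_mem_tail (List.of_mem_zip (List.getElem_mem hk)).2), ?_⟩
    simp [hL.getElem_inj_iff]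
  have hi' : i < ((L.zip L.tail).map fun p => (q p.1, q p.2)).length := by simpa using hi
  have hj' : j < ((L.zip L.tail).map fun p => (q p.1, q p.2)).length := by simpa using hj
  rw [List.getD_eq_getElem _ _ hi', List.getD_eq_getElem _ _ hj', List.getD_eq_getElem _ _ hj,
    List.getElem_map, List.getElem_map, Function.comp_apply, cr]
  by_cases hij : j = i
  · subst hij
    simp [not_chordCross_self]
  · obtain ⟨h1, h2, h3⟩ := mem hi
    obtain ⟨h4, h5, h6⟩ := mem hj
    have := hq.segCross_iff h1 h2 h4 h5 h3 h6 fun h => hij (zip_tail_injective hL hi hj h).symm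
    simp only [this, ne_eq, hij, not_false_eq_true, true_and]

theorem Clockwise.two_mul_crossNum_eq {m : ℕ} {q : ℕ → Pt} (hq : Clockwise m q) {L : List ℕ}
    (hL : L.Nodup) (hm : ∀ x ∈ L, x < m) :
    2 * crossNum (pathEdges (L.map q)) = selfCr (walkEdges L) := by
  have h0 : (pathEdges (L.map q)).length = (L.zip L.tail).length := by
    rw [pathEdges_map, List.length_map]
  rw [two_mul_crossNum, selfCr, mutualCr]
  nth_rw 2 [walkEdges_eq_map_zip]
  rw [Multiset.map_coe, Multiset.sum_coe, List.map_map, sum_map_eq_sum_range _ (0, 0), h0]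
  refine Finset.sum_congr rfl fun i hi => ?_
  rw [Finset.mem_range] at hi
  rw [hq.edgeCrossCount_eq hL hm hi, List.getD_eq_getElem _ _ hi]
  rfl

theorem ends_range (k : ℕ) : Ends (List.range (k + 1)) 0 k where
  head := by
    rw [List.range_succ_eq_map]
    rfl
  last := by
    rw [List.range_succ]
    exact List.getLast?_concat

theorem walkEdges_range (k : ℕ) :
    walkEdges (List.range (k + 1)) = (Multiset.range k).map fun i => s(i, i + 1) := by
  induction k with
  | zero => rfl
  | succ k ih =>
    have h := ends_range k
    rw [List.range_succ, walkEdges_append h (ends_singleton (k + 1)), ih, Multiset.range_succ,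
      Multiset.map_cons, walkEdges, add_zero, add_comm, Multiset.singleton_add]

theorem closedEdges_range (m : ℕ) :
    closedEdges (List.range m) = (Multiset.range m).map fun i => s(i, (i + 1) % m) := by
  cases m with
  | zero => rfl
  | succ k =>
    have h := ends_range k
    rw [closedEdges_eq h, walkEdges_range, Multiset.range_succ, Multiset.map_cons,
      Nat.mod_self, add_comm, Multiset.singleton_add]
    congr 1
    refine Multiset.map_congr rfl fun i hi => ?_
    rw [Multiset.mem_range] at hi
    rw [Nat.mod_eq_of_lt (by omega)]

theorem sum_range_mod_succ (m : ℕ) (f : ℕ → ℕ) :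
    ∑ i ∈ Finset.range m, f ((i + 1) % m) = ∑ i ∈ Finset.range m, f i := by
  cases m with
  | zero => rfl
  | succ k =>
    rw [Finset.sum_range_succ, Finset.sum_range_succ', Nat.mod_self]
    congr 1
    refine Finset.sum_congr rfl fun i hi => ?_
    rw [Finset.mem_range] at hi
    rw [Nat.mod_eq_of_lt (by omega)]

/-- In a cyclic binary word, both kinds of color changes are equally frequent. -/
theorem colorChanges_range (χ : ℕ → Bool) (m : ℕ) : colorChanges χ (List.range m) =
    2 * ∑ i ∈ Finset.range m, if χ i = false ∧ χ ((i + 1) % m) = true then 1 else 0 := by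
  have h1 : colorChanges χ (List.range m) =
      ∑ i ∈ Finset.range m, if χ i ≠ χ ((i + 1) % m) then 1 else 0 := by
    rw [colorChanges, closedEdges_range, Multiset.countP_map, ← Finset.card_filter]
    simp only [bi_mk]
    rfl
  have h2 := sum_range_mod_succ m fun i => if χ i = true then 1 else 0
  have h3 : ∑ i ∈ Finset.range m, (if χ i ≠ χ ((i + 1) % m) then 1 else 0) +
      ∑ i ∈ Finset.range m, (if χ ((i + 1) % m) = true then 1 else 0) =
      2 * ∑ i ∈ Finset.range m, (if χ i = false ∧ χ ((i + 1) % m) = true then 1 else 0) +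
      ∑ i ∈ Finset.range m, if χ i = true then 1 else 0 := by
    rw [Finset.mul_sum, ← Finset.sum_add_distrib, ← Finset.sum_add_distrib]
    refine Finset.sum_congr rfl fun i _ => ?_
    cases χ i <;> cases χ ((i + 1) % m) <;> simp
  rw [h1]
  omega

theorem sum_range_mod_pred (m : ℕ) (f : ℕ → ℕ → ℕ) :
    ∑ i ∈ Finset.range m, f ((i + (m - 1)) % m) i =
      ∑ i ∈ Finset.range m, f i ((i + 1) % m) := by
  cases m with
  | zero => rfl
  | succ k =>
    rw [Finset.sum_range_succ', Finset.sum_range_succ, Nat.mod_self, zero_add,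
      Nat.add_sub_cancel, Nat.mod_eq_of_lt (Nat.lt_succ_self k)]
    congr 1
    refine Finset.sum_congr rfl fun i hi => ?_
    rw [Finset.mem_range] at hi
    rw [Nat.mod_eq_of_lt (show i + 1 < k + 1 by omega), show i + 1 + k = i + (k + 1) by ring,
      Nat.add_mod_right, Nat.mod_eq_of_lt (by omega)]

/-- `q 0, …, q (m - 1)` is a clockwise listing of the bicolored set `R ∪ B`,
the colors being recorded by `χ`. -/
structure ColoredListing (R B : Finset Pt) (m : ℕ) (q : ℕ → Pt) (χ : ℕ → Bool) : Prop where
  clockwise : Clockwise m q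
  inj : ∀ i < m, ∀ j < m, q i = q j → i = j
  exists_index : ∀ p ∈ R ∪ B, ∃ i < m, q i = p
  mem_red : ∀ i < m, (q i ∈ R ↔ χ i = true)
  mem_blue : ∀ i < m, (q i ∈ B ↔ χ i = false)

section ColoredListing

variable {R B : Finset Pt} {m : ℕ} {q : ℕ → Pt} {χ : ℕ → Bool}

theorem ColoredListing.bichromatic_iff (h : ColoredListing R B m q χ) {i j : ℕ} (hi : i < m)
    (hj : j < m) : Bichromatic R B (q i, q j) ↔ Bi χ s(i, j) := by
  rw [bi_mk, Bichromatic, h.mem_red i hi, h.mem_red j hj, h.mem_blue i hi, h.mem_blue j hj]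
  cases χ i <;> cases χ j <;> simp

theorem ColoredListing.mem_union (h : ColoredListing R B m q χ) {i : ℕ} (hi : i < m) :
    q i ∈ R ∪ B := by
  rw [Finset.mem_union, h.mem_red i hi, h.mem_blue i hi]
  cases χ i <;> simp

theorem ColoredListing.bichromatic_pathEdges_iff (h : ColoredListing R B m q χ) {L : List ℕ}
    (hL : ∀ x ∈ L, x < m) : (∀ e ∈ pathEdges (L.map q), Bichromatic R B e) ↔
      ∀ e ∈ walkEdges L, Bi χ e := by
  rw [pathEdges_map, walkEdges_eq_map_zip]
  simp only [List.forall_mem_map, Multiset.mem_coe]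
  refine forall₂_congr fun p hp => ?_
  exact h.bichromatic_iff (hL _ (List.of_mem_zip hp).1)
    (hL _ (List.mem_of_mem_tail (List.of_mem_zip hp).2))

theorem ColoredListing.exists_walk (h : ColoredListing R B m q χ) {i j : ℕ} (hi : i < m)
    (hj : j < m) (P : HamAltPath R B (q i) (q j)) : ∃ L : List ℕ, P.verts = L.map q ∧
      L.Perm (List.range m) ∧ Ends L i j ∧ ∀ e ∈ walkEdges L, Bi χ e := by
  have hmem : ∀ p, p ∈ P.verts ↔ p ∈ R ∪ B := fun p => by rw [← P.cover, List.mem_toFinset]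
  choose! f hf hqf using h.exists_index
  have hL : P.verts = (P.verts.map f).map q := by
    rw [List.map_map]
    refine (List.map_id P.verts).symm.trans (List.map_congr_left fun p hp => ?_)
    exact (hqf p ((hmem p).1 hp)).symm
  have hlt : ∀ x ∈ P.verts.map f, x < m := by
    intro x hx
    obtain ⟨p, hp, rfl⟩ := List.mem_map.1 hx
    exact hf p ((hmem p).1 hp)
  have hfq : ∀ x < m, f (q x) = x := fun x hx =>
    h.inj _ (hf _ (h.mem_union hx)) _ hx (hqf _ (h.mem_union hx))
  have hnd : (P.verts.map f).Nodup := by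
    have := P.nodup
    rw [hL] at this
    exact this.of_map q
  refine ⟨P.verts.map f, hL, ?_, ⟨?_, ?_⟩, ?_⟩
  · rw [List.perm_ext_iff_of_nodup hnd List.nodup_range]
    intro x
    rw [List.mem_range]
    refine ⟨hlt x, fun hx => ?_⟩
    exact List.mem_map.2 ⟨q x, (hmem _).2 (h.mem_union hx), hfq x hx⟩
  · rw [List.head?_map, P.head_eq, Option.map_some, hfq i hi]
  · rw [List.getLast?_map, P.last_eq, Option.map_some, hfq j hj]
  · rw [← h.bichromatic_pathEdges_iff hlt, ← hL]
    exact P.alt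

theorem ColoredListing.exists_path (h : ColoredListing R B m q χ) {i j : ℕ} {L : List ℕ}
    (hL : L.Perm (List.range m)) (hij : Ends L i j) (halt : ∀ e ∈ walkEdges L, Bi χ e) :
    ∃ P : HamAltPath R B (q i) (q j), P.verts = L.map q := by
  have hlt : ∀ x, x ∈ L ↔ x < m := fun x => by rw [hL.mem_iff, List.mem_range]
  refine ⟨⟨L.map q, ?_, ?_, ?_, ?_, ?_⟩, rfl⟩
  · exact (hL.nodup_iff.2 List.nodup_range).map_on fun x hx y hy =>
      h.inj x ((hlt x).1 hx) y ((hlt y).1 hy)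
  · ext p
    rw [List.mem_toFinset, List.mem_map]
    constructor
    · rintro ⟨x, hx, rfl⟩
      exact h.mem_union ((hlt x).1 hx)
    · intro hp
      obtain ⟨x, hx, rfl⟩ := h.exists_index p hp
      exact ⟨x, (hlt x).2 hx, rfl⟩
  · rw [List.head?_map, hij.head, Option.map_some]
  · rw [List.getLast?_map, hij.last, Option.map_some]
  · exact (h.bichromatic_pathEdges_iff fun x => (hlt x).1).2 halt

theorem ColoredListing.countP_red (h : ColoredListing R B m q χ) :
    (List.range m).countP (χ · == true) = R.card := by
  have h1 : R = ((Finset.range m).filter fun i => χ i == true).image q := by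
    ext p
    simp only [Finset.mem_image, Finset.mem_filter, Finset.mem_range, beq_iff_eq]
    constructor
    · intro hp
      obtain ⟨i, hi, rfl⟩ := h.exists_index p (Finset.mem_union_left _ hp)
      exact ⟨i, ⟨hi, (h.mem_red i hi).1 hp⟩, rfl⟩
    · rintro ⟨i, ⟨hi, hc⟩, rfl⟩
      exact (h.mem_red i hi).2 hc
  rw [h1, Finset.card_image_of_injOn]
  · rw [Finset.card_def, Finset.filter_val, ← Multiset.countP_eq_card_filter, Finset.range_val,
      ← Multiset.coe_range, Multiset.coe_countP]
    simp
  · intro i hi j hj hij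
    rw [Finset.mem_coe, Finset.mem_filter, Finset.mem_range] at hi hj
    exact h.inj i hi.1 j hj.1 hij

theorem ColoredListing.not (h : ColoredListing R B m q χ) :
    ColoredListing B R m q (fun i => !χ i) where
  clockwise := h.clockwise
  inj := h.inj
  exists_index p hp := h.exists_index p (by rwa [Finset.union_comm])
  mem_red i hi := by simp [h.mem_blue i hi]
  mem_blue i hi := by simp [h.mem_red i hi]

theorem ColoredListing.countP_blue (h : ColoredListing R B m q χ) :
    (List.range m).countP (χ · == false) = B.card := by
  rw [← h.not.countP_red]
  congr 1
  funext i
  cases χ i <;> rfl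

theorem isEdgeOf_of_mem_walkEdges {L : List ℕ} {i j : ℕ} (h : s(i, j) ∈ walkEdges L) :
    IsEdgeOf (pathEdges (L.map q)) (q i) (q j) := by
  rw [walkEdges_eq_map_zip, Multiset.mem_coe, List.mem_map] at h
  obtain ⟨p, hp, he⟩ := h
  rw [IsEdgeOf, pathEdges_map]
  rcases Sym2.eq_iff.1 he with ⟨rfl, rfl⟩ | ⟨rfl, rfl⟩
  · exact Or.inl (List.mem_map.2 ⟨p, hp, rfl⟩)
  · exact Or.inr (List.mem_map.2 ⟨p, hp, rfl⟩)

end ColoredListing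

/-- Closing a Hamiltonian walk along a gap creates no crossing. -/
theorem selfCr_closedEdges_of_gap {w L : List ℕ} {i j : ℕ} (hw : w.Pairwise (· < ·))
    (hL : L.Perm w) (hij : Ends L i j) (hg : s(j, i) ∈ closedEdges w) :
    selfCr (closedEdges L) = selfCr (walkEdges L) := by
  have h1 : mutualCr {s(j, i)} (walkEdges L) = 0 := by
    refine mutualCr_eq_zero.2 fun e he f hf => ?_
    rw [Multiset.mem_singleton.1 he]
    induction f with | _ x y
    obtain ⟨hx, hy⟩ := mem_of_mem_walkEdges hf
    exact not_chordCross_of_mem_closedEdges hw hg (hL.mem_iff.1 hx) (hL.mem_iff.1 hy)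
  rw [closedEdges_eq hij, selfCr_add, mutualCr_comm, h1]
  simp [selfCr, mutualCr, cr_self]

theorem ColoredListing.optimum {R B : Finset Pt} {n m : ℕ} {q : ℕ → Pt} {χ : ℕ → Bool}
    (h : ColoredListing R B m q χ) (hR : R.card = n) (hB : B.card = n) {i j : ℕ} (hi : i < m)
    (hj : j < m) (hχ : χ i ≠ χ j) (hg : s(j, i) ∈ closedEdges (List.range m))
    (P : HamAltPath R B (q i) (q j)) (hP : OptimumPath R B (q i) (q j) P) :
    2 * crossNum (pathEdges P.verts) + colorChanges χ (List.range m) = m ∧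
      OnePlane (pathEdges P.verts) ∧
      ∀ x y, s(x, y) ∈ closedEdges (List.range m) → Bi χ s(x, y) → s(x, y) ≠ s(j, i) →
        IsEdgeOf (pathEdges P.verts) (q x) (q y) := by
  have hw : (List.range m).Pairwise (· < ·) := List.pairwise_lt_range
  have cross : ∀ {L : List ℕ}, L.Perm (List.range m) → Ends L i j →
      2 * crossNum (pathEdges (L.map q)) = selfCr (closedEdges L) := by
    intro L hL hij
    rw [selfCr_closedEdges_of_gap hw hL hij hg]
    exact h.clockwise.two_mul_crossNum_eq (hL.nodup_iff.2 List.nodup_range)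
      fun x hx => List.mem_range.1 (hL.mem_iff.1 hx)
  obtain ⟨L, hPL, hL, hij, halt⟩ := h.exists_walk hi hj P
  rw [OptimumPath, hPL] at hP
  rw [hPL]
  have hLm : ∀ x ∈ L, x < m := fun x hx => List.mem_range.1 (hL.mem_iff.1 hx)
  have hbal : ColorBalanced χ (List.range m) := by
    rw [colorBalanced_iff true, Bool.not_true, h.countP_red, h.countP_blue, hR, hB]
  obtain ⟨l, hl⟩ := exists_tight hw hbal
  obtain ⟨l', hl1, hl2, hl3⟩ :=
    exists_ends_of_mem_closedEdges (hl.mem_of_bi hw (Sym2.eq_swap ▸ hg) (bi_mk.2 hχ))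
  have hl' := hl.alternating
  rw [Alternating, ← hl3, closedEdges_eq hl1] at hl'
  obtain ⟨Q, hQ⟩ := h.exists_path (hl2.trans hl.perm) hl1
    fun e he => hl' e (Multiset.mem_add.2 (Or.inl he))
  have h1 := hP Q
  rw [hQ] at h1
  have h2 := cross hL hij
  have h3 := cross (hl2.trans hl.perm) hl1
  rw [hl3] at h3
  have h4 := hl.selfCr_le
  have hT : Tight χ (List.range m) L :=
    ⟨hL, (alternating_iff hij).2 ⟨halt, hχ.symm⟩, by omega⟩
  have h5 := hT.selfCr_le
  have h6 := length_le_selfCr_add_colorChanges hw hL hT.alternating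
  rw [List.length_range] at h5 h6
  refine ⟨by omega, fun k hk => ?_, fun x y hxy hb hne => ?_⟩
  · rw [Finset.mem_range, pathEdges_map, List.length_map] at hk
    rw [h.clockwise.edgeCrossCount_eq (hL.nodup_iff.2 List.nodup_range) hLm hk]
    have he : s((L.zip L.tail)[k].1, (L.zip L.tail)[k].2) ∈ closedEdges L := by
      rw [closedEdges_eq hij, walkEdges_eq_map_zip, Multiset.mem_add, Multiset.mem_coe]
      exact Or.inl (List.mem_map.2 ⟨_, List.getElem_mem hk, rfl⟩)
    refine le_trans ?_ (hT.sum_cr_le_one hw he)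
    rw [closedEdges_eq hij, Multiset.map_add, Multiset.sum_add]
    exact Nat.le_add_right _ _
  · have := hT.mem_of_bi hw hxy hb
    rw [closedEdges_eq hij, Multiset.mem_add, Multiset.mem_singleton] at this
    exact isEdgeOf_of_mem_walkEdges (this.resolve_right hne)

theorem coloredListing_of_cwList {R B : Finset Pt} {m : ℕ} (hm : 0 < m) {pt : Fin m → Pt}
    (hdisj : Disjoint R B) (hcw : CWList pt) (hcover : Finset.univ.image pt = R ∪ B) :
    ColoredListing R B m (fun i => pt ⟨i % m, Nat.mod_lt _ hm⟩)
      (fun i => decide (pt ⟨i % m, Nat.mod_lt _ hm⟩ ∈ R)) where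
  clockwise i j k hij hjk hk := by
    refine hcw.2 _ _ _ ?_ ?_ <;> rw [Fin.mk_lt_mk]
    · rwa [Nat.mod_eq_of_lt (by omega), Nat.mod_eq_of_lt (by omega)]
    · rwa [Nat.mod_eq_of_lt (by omega), Nat.mod_eq_of_lt hk]
  inj i hi j hj h := by
    have := Fin.mk.inj_iff.1 (hcw.1 h)
    rwa [Nat.mod_eq_of_lt hi, Nat.mod_eq_of_lt hj] at this
  exists_index p hp := by
    rw [← hcover, Finset.mem_image] at hp
    obtain ⟨i, -, rfl⟩ := hp
    exact ⟨i, i.2, congrArg pt (Fin.ext (Nat.mod_eq_of_lt i.2))⟩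
  mem_red i _ := by simp
  mem_blue i _ := by
    have h : pt ⟨i % m, Nat.mod_lt _ hm⟩ ∈ R ∪ B := by
      rw [← hcover]
      exact Finset.mem_image_of_mem _ (Finset.mem_univ _)
    rw [decide_eq_false_iff_not]
    exact ⟨fun hB hR => Finset.disjoint_left.1 hdisj hR hB, (Finset.mem_union.1 h).resolve_left⟩

theorem two_mul_runCount {R B : Finset Pt} {m : ℕ} (hm : 0 < m) {pt : Fin m → Pt} {χ : ℕ → Bool}
    (h : ColoredListing R B m (fun i => pt ⟨i % m, Nat.mod_lt _ hm⟩) χ) (hB : B.Nonempty) :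
    2 * runCount hm R B pt = colorChanges χ (List.range m) := by
  have hpt : ∀ i : Fin m, pt ⟨i.val % m, Nat.mod_lt _ hm⟩ = pt i := fun i =>
    congrArg pt (Fin.ext (Nat.mod_eq_of_lt i.2))
  have hred : ∀ i : Fin m, pt i ∈ R ↔ χ i = true := fun i => by rw [← h.mem_red i i.2, hpt]
  have hblue : ∀ i : Fin m, pt i ∈ B ↔ χ i = false := fun i => by rw [← h.mem_blue i i.2, hpt]
  have hall : ¬ ∀ i : Fin m, pt i ∈ R := by
    obtain ⟨p, hp⟩ := hB
    obtain ⟨i, hi, rfl⟩ := h.exists_index p (Finset.mem_union_right _ hp)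
    intro hR
    have h1 := (h.mem_blue i hi).1 hp
    rw [(hred ⟨i, hi⟩).1 (hR _)] at h1
    exact absurd h1 (by simp)
  rw [runCount, if_neg hall, colorChanges_range, Finset.card_filter,
    ← sum_range_mod_pred m fun i j => if χ i = false ∧ χ j = true then 1 else 0,
    ← Fin.sum_univ_eq_sum_range
      fun i => if χ ((i + (m - 1)) % m) = false ∧ χ i = true then 1 else 0]
  congr 1
  refine Finset.sum_congr rfl fun i _ => ?_
  exact if_congr (by rw [hred, hblue, and_comm]; rfl) rfl rfl

/-- Corollary 3.2(i): for `S = R ∪ B` in convex position (listed clockwise by `pt`) with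
`|R| = |B| = n ≥ 2` and consecutive points `r ∈ R`, `b ∈ B`, every optimum Hamiltonian
alternating path on `S` with endpoints `r` and `b` has exactly `n − r(S)` crossings, is
1-plane, and contains every bridge of `S` as an edge except for the edge `rb`. -/
theorem stmt9 (n : ℕ) (hn : 2 ≤ n) (R B : Finset Pt)
    (hdisj : Disjoint R B)
    (hR : R.card = n) (hB : B.card = n)
    (m : ℕ) (hm : 0 < m) (pt : Fin m → Pt)
    (hcw : CWList pt) (hcover : Finset.univ.image pt = R ∪ B)
    (r b : Pt) (hr : r ∈ R) (hb : b ∈ B)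
    (hcons : ∃ i : Fin m,
      (pt i = r ∧ pt (cycSucc hm i) = b) ∨ (pt i = b ∧ pt (cycSucc hm i) = r)) :
    ∀ P : HamAltPath R B r b, OptimumPath R B r b P →
      crossNum (pathEdges P.verts) = n - runCount hm R B pt ∧
      OnePlane (pathEdges P.verts) ∧
      ∀ i : Fin m, Bichromatic R B (pt i, pt (cycSucc hm i)) →
        ¬ ((pt i = r ∧ pt (cycSucc hm i) = b) ∨ (pt i = b ∧ pt (cycSucc hm i) = r)) →
        IsEdgeOf (pathEdges P.verts) (pt i) (pt (cycSucc hm i)) := by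
  intro P hP
  have h := coloredListing_of_cwList hm hdisj hcw hcover
  have hpt : ∀ i : Fin m, pt ⟨i.val % m, Nat.mod_lt _ hm⟩ = pt i := fun i =>
    congrArg pt (Fin.ext (Nat.mod_eq_of_lt i.2))
  have hgap : ∀ i : Fin m, s(i.val, (cycSucc hm i).val) ∈ closedEdges (List.range m) := by
    intro i
    rw [closedEdges_range]
    exact Multiset.mem_map_of_mem _ (Multiset.mem_range.2 i.2)
  obtain ⟨i, j, rfl, rfl, hij⟩ : ∃ i j : Fin m, pt i = r ∧ pt j = b ∧
      s(j.val, i.val) ∈ closedEdges (List.range m) := by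
    obtain ⟨i, ⟨h1, h2⟩ | ⟨h1, h2⟩⟩ := hcons
    · exact ⟨i, _, h1, h2, Sym2.eq_swap ▸ hgap i⟩
    · exact ⟨_, i, h2, h1, hgap i⟩
  have hi := (h.mem_red i i.2).1 (by rwa [hpt])
  have hj := (h.mem_blue j j.2).1 (by rwa [hpt])
  have hmn : m = 2 * n := by
    have h1 := Finset.card_image_of_injective Finset.univ hcw.1
    rw [hcover, Finset.card_union_of_disjoint hdisj, hR, hB, Finset.card_univ,
      Fintype.card_fin] at h1
    omega
  have hopt := h.optimum hR hB i.2 j.2 (by rw [hi, hj]; simp) hij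
  beta_reduce at hopt
  rw [hpt, hpt] at hopt
  obtain ⟨h1, h2, h3⟩ := hopt P hP
  have h4 := two_mul_runCount hm h ⟨_, hb⟩
  refine ⟨by omega, h2, fun k hk hne => ?_⟩
  have h5 := h3 k (cycSucc hm k) (hgap k) ?_ ?_
  · rwa [hpt, hpt] at h5
  · rw [← h.bichromatic_iff k.2 (cycSucc hm k).2]
    simpa only [hpt] using hk
  · intro he
    refine hne ?_
    rcases Sym2.eq_iff.1 he with ⟨h6, h7⟩ | ⟨h6, h7⟩
    · rw [Fin.ext h7, Fin.ext h6]
      exact Or.inr ⟨rfl, rfl⟩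
    · rw [Fin.ext h7, Fin.ext h6]
      exact Or.inl ⟨rfl, rfl⟩

end
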